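/- arXiv:2507.11880 — 3 statements merged into one kernel-verified Lean document; each statement's English description precedes it below -/
import Mathlib

section
/- Let X_free be a compact, path-connected subset of ℝ² equal to a finite union of convex polygons in which every path-homotopy class contains a path of minimal cost. Fix an anchor x⋆, tether length ζ ≥ 0, a home configuration ς_s (a path from x⋆ to x_s with c(ς_s) ≤ ζ), and goals x₁,…,x_N ∈ X_free. Suppose γ* = σ_1 * … * σ_{N+1} is a feasible TMV loop (each σ_i a path from x_{i−1} to x_i with x_0 = x_{N+1} = x_s, m[ς_s * γ*_{[0,t]}] ≤ ζ for all t, and ς_s * γ* ≃_p ς_s) that minimizes cost among all feasible TMV loops. Then there exist optimal homotopic paths ς*_1, …, ς*_N, with ς*_i a path from x⋆ to x_i and c(ς*_i) ≤ ζ, such that, setting ς*_0 := ς_s and ς*_{N+1} := ς_s, for every i = 1,…,N+1 the subpath σ_i is an optimal homotopic path satisfying σ_i ≃_p ς̄*_{i−1} * ς*_i. -/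
noncomputable section

/-- Points of the plane. -/
abbrev E2 : Type := EuclideanSpace ℝ (Fin 2)

namespace THPP

lemma subIcc_mem (s t₁ t₂ : unitInterval) :
    (1 - s.1) * t₁.1 + s.1 * t₂.1 ∈ Set.Icc (0 : ℝ) 1 := by
  have hs0 : (0:ℝ) ≤ s.1 := s.2.1
  have hs1 : s.1 ≤ 1 := s.2.2
  have ha0 : (0:ℝ) ≤ t₁.1 := t₁.2.1
  have ha1 : t₁.1 ≤ 1 := t₁.2.2
  have hb0 : (0:ℝ) ≤ t₂.1 := t₂.2.1
  have hb1 : t₂.1 ≤ 1 := t₂.2.2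
  constructor
  · have h1 := mul_nonneg (by linarith : (0:ℝ) ≤ 1 - s.1) ha0
    have h2 := mul_nonneg hs0 hb0
    linarith
  · have h1 := mul_nonneg (by linarith : (0:ℝ) ≤ 1 - s.1) (by linarith : (0:ℝ) ≤ 1 - t₁.1)
    have h2 := mul_nonneg hs0 (by linarith : (0:ℝ) ≤ 1 - t₂.1)
    nlinarith

/-- The subpath `σ_{[t₁,t₂]} : s ↦ σ ((1-s)·t₁ + s·t₂)`. -/
def subpath {Y : Type*} [TopologicalSpace Y] {a b : Y} (σ : Path a b) (t₁ t₂ : unitInterval) :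
    Path (σ t₁) (σ t₂) where
  toFun s := σ ⟨(1 - s.1) * t₁.1 + s.1 * t₂.1, subIcc_mem s t₁ t₂⟩
  continuous_toFun := σ.continuous.comp (Continuous.subtype_mk (by fun_prop) _)
  source' := by
    exact congrArg (fun u => σ u) (Subtype.ext (by simp))
  target' := by
    exact congrArg (fun u => σ u) (Subtype.ext (by simp))

/-- The subpath `σ_{[0,t]}`, as a path from the start point of `σ` to `σ t`. -/
def subpath0 {Y : Type*} [TopologicalSpace Y] {a b : Y} (σ : Path a b) (t : unitInterval) :
    Path a (σ t) :=
  (subpath σ 0 t).cast σ.source.symm rfl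

/-- The straight-line path `t ↦ (1-t)·x₀ + t·x₁`, as a path in `X` given that the
segment `[x₀, x₁]` is contained in `X`. -/
def linePath {X : Set E2} {x₀ x₁ : E2} (h₀ : x₀ ∈ X) (h₁ : x₁ ∈ X)
    (hseg : segment ℝ x₀ x₁ ⊆ X) : Path (⟨x₀, h₀⟩ : X) ⟨x₁, h₁⟩ where
  toFun t := ⟨(1 - t.1) • x₀ + t.1 • x₁,
    hseg (by rw [segment_eq_image]; exact ⟨t.1, t.2, rfl⟩)⟩
  continuous_toFun := Continuous.subtype_mk (by fun_prop) _
  source' := Subtype.ext (by simp)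
  target' := Subtype.ext (by simp)

/-- The cost (arc length) of a path in a subset of the plane: the total variation of the
underlying map `[0,1] → ℝ²`. -/
def cost {X : Set E2} {a b : X} (σ : Path a b) : ENNReal :=
  eVariationOn (fun t => (σ t : E2)) Set.univ

/-- A path is an optimal homotopic path if it has minimal cost within its
path-homotopy class (homotopies staying in `X`). -/
def IsOptimal {X : Set E2} {a b : X} (σ : Path a b) : Prop :=
  ∀ σ' : Path a b, σ.Homotopic σ' → cost σ ≤ cost σ'

/-- `m[σ]`: the infimal cost of the path-homotopy class of `σ`. -/
def mCost {X : Set E2} {a b : X} (σ : Path a b) : ENNReal :=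
  ⨅ σ' : {σ' : Path a b // σ.Homotopic σ'}, cost σ'.1

/-- Concatenation `σ₀ * σ₁ * ⋯ * σ_{n-1}` of a chain of paths. -/
def chain {Y : Type*} [TopologicalSpace Y] (x : ℕ → Y)
    (σ : ∀ i : ℕ, Path (x i) (x (i + 1))) : ∀ n : ℕ, Path (x 0) (x n)
  | 0 => Path.refl (x 0)
  | n + 1 => (chain x σ n).trans (σ n)


/-- A family `σ` of connecting paths is a feasible TMV loop for home configuration
`ςs` and tether length ζ: the taut tether length stays within ζ along the loop
`γ = σ₀ * ⋯ * σ_N`, and the final configuration is homotopic to the home one. -/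
def FeasibleTMV {X : Set E2} {xstar : X} (ζ : ℝ) (N : ℕ) (x : ℕ → X)
    (hxN : x (N + 1) = x 0) (ςs : Path xstar (x 0))
    (σ : ∀ i : ℕ, Path (x i) (x (i + 1))) : Prop :=
  (∀ t : unitInterval,
      mCost (ςs.trans (subpath0 (chain x σ (N + 1)) t)) ≤ ENNReal.ofReal ζ) ∧
  (ςs.trans (chain x σ (N + 1))).Homotopic (ςs.cast rfl hxN)


end THPP
section
namespace THPP
local notation "I" => unitInterval

/-- heterogeneous path homotopy -/
def HR {Y : Type*} [TopologicalSpace Y] {a b c d : Y} (p : Path a b) (q : Path c d) : Prop :=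
  ∃ (h1 : a = c) (h2 : b = d), p.Homotopic (q.cast h1 h2)

namespace HR
variable {Y : Type*} [TopologicalSpace Y] {a b c d e f : Y}

lemma of_hom {p q : Path a b} (h : p.Homotopic q) : HR p q := ⟨rfl, rfl, h⟩

lemma hom {p q : Path a b} (h : HR p q) : p.Homotopic q := by
  obtain ⟨_, _, h⟩ := h; exact h

lemma rfl' {p : Path a b} : HR p p := of_hom (Path.Homotopic.refl p)

lemma symm {p : Path a b} {q : Path c d} (h : HR p q) : HR q p := by
  obtain ⟨rfl, rfl, h⟩ := h
  exact of_hom (Path.Homotopic.symm h)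

lemma trans {p : Path a b} {q : Path c d} {r : Path e f} (h : HR p q) (h' : HR q r) : HR p r := by
  obtain ⟨rfl, rfl, h⟩ := h
  obtain ⟨rfl, rfl, h'⟩ := h'
  exact of_hom (Path.Homotopic.trans h h')

lemma comp {a' b' c' : Y} {p : Path a b} {q : Path b c} {p' : Path a' b'} {q' : Path b' c'}
    (h : HR p p') (h' : HR q q') : HR (p.trans q) (p'.trans q') := by
  obtain ⟨rfl, rfl, h⟩ := h
  obtain ⟨_, rfl, h'⟩ := h'
  exact of_hom (Path.Homotopic.hcomp h h')

lemma cast {p : Path a b} (h : c = a) (h' : d = b) : HR (p.cast h h') p := by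
  subst h; subst h'; exact rfl'

lemma of_eq {p : Path a b} {q : Path c d} (h : ∀ t, p t = q t) : HR p q := by
  have h1 : a = c := by have := h 0; simpa using this
  have h2 : b = d := by have := h 1; simpa using this
  subst h1; subst h2
  have : p = q := by ext t; exact h t
  subst this; exact rfl'

lemma assoc (p : Path a b) (q : Path b c) (r : Path c d) :
    HR ((p.trans q).trans r) (p.trans (q.trans r)) :=
  of_hom ⟨Path.Homotopy.transAssoc p q r⟩

lemma trans_refl (p : Path a b) : HR (p.trans (Path.refl b)) p :=
  of_hom ⟨Path.Homotopy.transRefl p⟩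

lemma refl_trans (p : Path a b) : HR ((Path.refl a).trans p) p :=
  of_hom ⟨Path.Homotopy.reflTrans p⟩

lemma symm_trans (p : Path a b) : HR (p.symm.trans p) (Path.refl b) :=
  of_hom (Path.Homotopic.symm ⟨Path.Homotopy.reflSymmTrans p⟩)

lemma trans_symm (p : Path a b) : HR (p.trans p.symm) (Path.refl a) :=
  of_hom (Path.Homotopic.symm ⟨Path.Homotopy.reflTransSymm p⟩)

lemma subpath_trans (σ : Path a b) (s t u : I) :
    HR ((subpath σ s t).trans (subpath σ t u)) (subpath σ s u) :=
  trans (comp (of_eq (q := σ.subpath s t) fun x => rfl) (of_eq (q := σ.subpath t u) fun x => rfl))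
    (trans (of_hom ⟨Path.Homotopy.subpathTransSubpath σ s t u⟩)
      (of_eq (q := subpath σ s u) fun x => rfl))

lemma subpath_zero_one (σ : Path a b) : HR (subpath σ 0 1) σ :=
  of_eq fun t => congrArg σ (Subtype.ext (by simp))

lemma subpath0 (σ : Path a b) (t : I) : HR (subpath0 σ t) (subpath σ 0 t) := cast _ _

lemma subpath0_trans (σ : Path a b) (s t : I) :
    HR ((THPP.subpath0 σ s).trans (subpath σ s t)) (THPP.subpath0 σ t) :=
  trans (comp (subpath0 _ _) rfl') (trans (subpath_trans _ _ _ _) (subpath0 _ _).symm)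

lemma subpath0_one (σ : Path a b) : HR (THPP.subpath0 σ 1) σ :=
  trans (subpath0 _ _) (subpath_zero_one _)

lemma subpath0_zero (σ : Path a b) : HR (THPP.subpath0 σ 0) (Path.refl a) :=
  of_eq fun t => by
    have : σ ⟨(1 - t.1) * (0:I).1 + t.1 * (0:I).1, subIcc_mem t 0 0⟩ = a := by
      rw [show (⟨(1 - t.1) * (0:I).1 + t.1 * (0:I).1, subIcc_mem t 0 0⟩ : I) = 0 from
        Subtype.ext (by simp)]
      simp
    exact this

end HR

variable {X : Set E2}

lemma cost_congr {a b c d : X} {p : Path a b} {q : Path c d} (h : ∀ t, p t = q t) :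
    cost p = cost q := by
  unfold cost
  congr 1
  funext t; rw [h]

lemma cost_cast {a b c d : X} (p : Path a b) (h : c = a) (h' : d = b) :
    cost (p.cast h h') = cost p := cost_congr fun _ => rfl

lemma cost_refl (a : X) : cost (Path.refl a) = 0 := by
  unfold cost
  apply eVariationOn.constant_on
  rintro _ ⟨t, _, rfl⟩ _ ⟨s, _, rfl⟩
  simp

lemma cost_symm {a b : X} (p : Path a b) : cost p.symm = cost p := by
  unfold cost
  have := eVariationOn.comp_eq_of_antitoneOn (fun t => (p t : E2)) (t := Set.univ) (unitInterval.symm : I → I)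
    (fun x _ y _ h => by simpa using h)
  have h2 : (unitInterval.symm : I → I) '' Set.univ = Set.univ := by
    rw [Set.image_univ]; exact unitInterval.symm_bijective.surjective.range_eq
  rw [h2] at this
  exact this

lemma edist_le_cost {a b : X} (p : Path a b) (s t : I) :
    edist (p s : E2) (p t) ≤ cost p :=
  eVariationOn.edist_le (fun t => (p t : E2)) (Set.mem_univ s) (Set.mem_univ t)

lemma cost_split {a b : X} (p : Path a b) (t : I) :
    eVariationOn (fun t => (p t : E2)) (Set.Icc 0 t) + eVariationOn (fun t => (p t : E2)) (Set.Icc t 1)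
      = cost p := by
  have := eVariationOn.Icc_add_Icc (fun t => (p t : E2)) (s := Set.univ) (a := 0) (b := t) (c := 1)
    t.2.1 t.2.2 (Set.mem_univ _)
  simp only [Set.univ_inter] at this
  rw [this]; unfold cost
  congr 1
  ext x; simp only [Set.mem_Icc, Set.mem_univ, iff_true]; exact ⟨x.2.1, x.2.2⟩

lemma edist_add_le_cost {a b : X} (p : Path a b) (t : I) :
    edist (a : E2) (p t) + edist (p t : E2) b ≤ cost p := by
  rw [← cost_split p t]
  have h1 := eVariationOn.edist_le (fun t => (p t : E2)) (s := Set.Icc 0 t) (x := 0) (y := t)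
    ⟨le_rfl, t.2.1⟩ ⟨t.2.1, le_rfl⟩
  have h2 := eVariationOn.edist_le (fun t => (p t : E2)) (s := Set.Icc t 1) (x := t) (y := 1)
    ⟨le_rfl, t.2.2⟩ ⟨t.2.2, le_rfl⟩
  simp only [Path.source, Path.target] at h1 h2
  exact add_le_add h1 h2

lemma cost_trans {a b c : X} (p : Path a b) (q : Path b c) :
    cost (p.trans q) = cost p + cost q := by
  have hh : (1/2:ℝ) ∈ Set.Icc (0:ℝ) 1 := by constructor <;> norm_num
  rw [← cost_split _ ⟨1/2, hh⟩]
  congr 1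
  · have := eVariationOn.comp_eq_of_monotoneOn (fun t => ((p.trans q) t : E2)) (t := Set.univ)
      (fun s : I => (⟨s.1 / 2, by constructor <;> linarith [s.2.1, s.2.2]⟩ : I))
      (fun x _ y _ h => by
        show x.1 / 2 ≤ y.1 / 2
        have : x.1 ≤ y.1 := h
        linarith)
    have h2 : (fun s : I => (⟨s.1 / 2, by constructor <;> linarith [s.2.1, s.2.2]⟩ : I)) '' Set.univ
        = Set.Icc 0 ⟨1/2, hh⟩ := by
      ext x
      simp only [Set.image_univ, Set.mem_range, Set.mem_Icc]
      constructor
      · rintro ⟨s, rfl⟩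
        refine ⟨by show (0:ℝ) ≤ s.1 / 2; linarith [s.2.1], by show s.1 / 2 ≤ 1/2; linarith [s.2.2]⟩
      · rintro ⟨h0, h1⟩
        have h1' : x.1 ≤ 1/2 := h1
        exact ⟨⟨2 * x.1, by constructor <;> linarith [x.2.1]⟩, Subtype.ext (by simp)⟩
    rw [h2] at this
    rw [← this]; unfold cost
    congr 1
    funext s
    simp only [Function.comp]
    rw [Path.trans_apply]
    have : s.1 / 2 ≤ 1 / 2 := by linarith [s.2.2]
    rw [dif_pos this]
    congr 2
    exact Subtype.ext (by simp; ring)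
  · have := eVariationOn.comp_eq_of_monotoneOn (fun t => ((p.trans q) t : E2)) (t := Set.univ)
      (fun s : I => (⟨(s.1 + 1) / 2, by constructor <;> linarith [s.2.1, s.2.2]⟩ : I))
      (fun x _ y _ h => by
        show (x.1+1) / 2 ≤ (y.1+1) / 2
        have : x.1 ≤ y.1 := h
        linarith)
    have h2 : (fun s : I => (⟨(s.1+1) / 2, by constructor <;> linarith [s.2.1, s.2.2]⟩ : I)) '' Set.univ
        = Set.Icc ⟨1/2, hh⟩ 1 := by
      ext x
      simp only [Set.image_univ, Set.mem_range, Set.mem_Icc]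
      constructor
      · rintro ⟨s, rfl⟩
        refine ⟨by show (1/2:ℝ) ≤ (s.1+1) / 2; linarith [s.2.1], by show (s.1+1) / 2 ≤ 1; linarith [s.2.2]⟩
      · rintro ⟨h0, h1⟩
        have h1' : 1/2 ≤ x.1 := h0
        exact ⟨⟨2 * x.1 - 1, by constructor <;> linarith [x.2.2]⟩, Subtype.ext (by simp)⟩
    rw [h2] at this
    rw [← this]; unfold cost
    congr 1
    funext s
    simp only [Function.comp]
    by_cases hs : s.1 = 0
    · have : s = 0 := Subtype.ext hs
      subst this
      rw [Path.trans_apply]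
      simp
    · rw [Path.trans_apply]
      have : ¬ (s.1 + 1) / 2 ≤ 1 / 2 := by
        have := lt_of_le_of_ne s.2.1 (Ne.symm hs)
        intro h; linarith
      rw [dif_neg this]
      congr 2
      exact Subtype.ext (by simp; ring)

/-- Lipschitz bound on the cost. -/
lemma cost_le_of_lip {a b : X} (p : Path a b) {K : ℝ} (hK : 0 ≤ K)
    (h : ∀ s t : I, dist (p s : E2) (p t) ≤ K * |s.1 - t.1|) : cost p ≤ ENNReal.ofReal K := by
  unfold cost
  have hl : LipschitzOnWith K.toNNReal (fun x : ℝ => (p (Set.projIcc 0 1 zero_le_one x) : E2))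
      (Set.Icc 0 1) := by
    refine LipschitzOnWith.of_dist_le_mul ?_
    intro x hx y hy
    rw [Set.projIcc_of_mem _ hx, Set.projIcc_of_mem _ hy, Real.coe_toNNReal _ hK, Real.dist_eq]
    exact h _ _
  have h1 := hl.comp_eVariationOn_le (f := fun x : ℝ => (p (Set.projIcc 0 1 zero_le_one x) : E2))
    (g := fun x : I => x.1) (s := Set.univ) (fun x _ => x.2)
  have h2 : eVariationOn (fun x : I => x.1) Set.univ ≤ 1 := by
    have := MonotoneOn.eVariationOn_eq (f := fun x : I => x.1) (s := Set.univ) (a := 0) (b := 1)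
      (fun x _ y _ h => h) (Set.mem_univ _) (Set.mem_univ _)
    have e : (Set.univ ∩ Set.Icc (0:I) 1) = Set.univ := by
      ext x; simp only [Set.univ_inter, Set.mem_Icc, Set.mem_univ, iff_true]; exact ⟨x.2.1, x.2.2⟩
    rw [e] at this

    rw [this]; simp
  have h3 : (fun x : ℝ => (p (Set.projIcc 0 1 zero_le_one x) : E2)) ∘ (fun x : I => x.1)
      = fun t => (p t : E2) := by
    funext t; simp [Function.comp]
  rw [h3] at h1
  refine h1.trans ?_
  calc (K.toNNReal : ENNReal) * eVariationOn (fun x : I => x.1) Set.univ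
      ≤ K.toNNReal * 1 := by gcongr
    _ = ENNReal.ofReal K := by rw [mul_one]; rfl

lemma cost_subpath_le {a b : X} (p : Path a b) {K : ℝ} (hK : 0 ≤ K)
    (h : ∀ s t : I, dist (p s : E2) (p t) ≤ K * |s.1 - t.1|) (s t : I) :
    cost (subpath p s t) ≤ ENNReal.ofReal (K * |s.1 - t.1|) := by
  apply cost_le_of_lip _ (by positivity)
  intro u v
  refine (h _ _).trans (le_of_eq ?_)
  rw [mul_assoc, ← abs_mul]
  show K * |(1 - u.1) * s.1 + u.1 * t.1 - ((1 - v.1) * s.1 + v.1 * t.1)| = _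
  rw [← abs_neg]; congr 2; ring

lemma mCost_le {a b c d : X} {p : Path a b} {q : Path c d} (h : HR p q) : mCost p ≤ cost q := by
  obtain ⟨rfl, rfl, h⟩ := h
  exact iInf_le_of_le ⟨q, h⟩ le_rfl

lemma mCost_congr {a b c d : X} {p : Path a b} {q : Path c d} (h : HR p q) : mCost p = mCost q := by
  apply le_antisymm
  · exact le_iInf fun r => mCost_le (h.trans (HR.of_hom r.2))
  · exact le_iInf fun r => mCost_le (h.symm.trans (HR.of_hom r.2))

lemma mCost_trans_le {a b c : X} (p : Path a b) (q : Path b c) :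
    mCost (p.trans q) ≤ mCost p + mCost q := by
  unfold mCost
  rw [ENNReal.iInf_add]
  refine le_iInf fun r => ?_
  rw [ENNReal.add_iInf]
  refine le_iInf fun r' => ?_
  rw [← cost_trans]
  exact iInf_le_of_le ⟨_, Path.Homotopic.hcomp r.2 r'.2⟩ le_rfl

end THPP
end
section
namespace THPP
local notation "I" => unitInterval
open Filter Topology
variable {X : Set E2}

lemma continuous_vft {f : I → E2} (hf : Continuous f) (hb : BoundedVariationOn f Set.univ) :
    Continuous (variationOnFromTo f Set.univ 0) := by
  rw [continuous_iff_continuousAt]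
  intro x
  have key : variationOnFromTo f Set.univ 0 = fun y => variationOnFromTo f Set.univ 0 x +
      ((eVariationOn f (Set.univ ∩ Set.Icc x y)).toReal
        - (eVariationOn f (Set.univ ∩ Set.Icc y x)).toReal) := by
    ext y
    rw [← variationOnFromTo.add hb.locallyBoundedVariationOn (Set.mem_univ 0) (Set.mem_univ x)
      (Set.mem_univ y)]
    congr 1
    unfold variationOnFromTo
    split_ifs with h
    · rw [eVariationOn.subsingleton f (s := Set.univ ∩ Set.Icc y x)]
      · simp
      · rintro a ⟨_, ha⟩ b ⟨_, hb⟩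
        exact le_antisymm (ha.2.trans (h.trans hb.1)) (hb.2.trans (h.trans ha.1))
    · rw [eVariationOn.subsingleton f (s := Set.univ ∩ Set.Icc x y)]
      · simp
      · rintro a ⟨_, ha⟩ b ⟨_, hb⟩
        exact absurd (ha.1.trans ha.2) h
  have h1 := hb.tendsto_eVariationOn_Icc_zero_right x hf.continuousWithinAt
  have h2 := hb.tendsto_eVariationOn_Icc_zero_left (x := x) hf.continuousWithinAt
  rw [nhdsWithin_univ] at h1 h2
  have h1' := (ENNReal.tendsto_toReal ENNReal.zero_ne_top).comp h1
  have h2' := (ENNReal.tendsto_toReal ENNReal.zero_ne_top).comp h2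
  have h3 := (tendsto_const_nhds (x := variationOnFromTo f Set.univ 0 x) (f := 𝓝 x)).add (h1'.sub h2')
  rw [key]
  unfold ContinuousAt
  have : (eVariationOn f (Set.univ ∩ Set.Icc x x)) = 0 := by
    apply eVariationOn.subsingleton; simp
  convert h3 using 2
  · rfl
  · beta_reduce
    rw [this]

/-- Constant speed reparametrization. -/
lemma exists_cs {a b : X} (p : Path a b) (hp : cost p ≠ ⊤) :
    ∃ q : Path a b, p.Homotopic q ∧ cost q ≤ cost p ∧
      ∀ s t : I, dist (q s : E2) (q t) ≤ (cost p).toReal * |s.1 - t.1| := by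
  set f : I → E2 := fun t => (p t : E2) with hf
  have hfc : Continuous f := continuous_subtype_val.comp p.continuous
  have hb : BoundedVariationOn f Set.univ := hp
  set V := variationOnFromTo f Set.univ 0 with hV
  have hVc : Continuous V := continuous_vft hfc hb
  set L := (cost p).toReal with hL
  have hL0 : 0 ≤ L := ENNReal.toReal_nonneg
  have hV0 : V 0 = 0 := variationOnFromTo.self _ _ _
  have huniv : Set.univ ∩ Set.Icc (0:I) 1 = Set.univ := by
    ext x; simp only [Set.univ_inter, Set.mem_Icc, Set.mem_univ, iff_true]; exact ⟨x.2.1, x.2.2⟩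
  have hV1 : V 1 = L := by
    rw [hV, variationOnFromTo.eq_of_le _ _ zero_le_one, huniv]; rfl
  have hmono : Monotone V := by
    have := variationOnFromTo.monotoneOn hb.locallyBoundedVariationOn (Set.mem_univ (0:I))
    exact fun x y h => this (Set.mem_univ x) (Set.mem_univ y) h
  have hd' : ∀ x y : I, x ≤ y → dist (f x) (f y) ≤ V y - V x := by
    intro x y h
    have e : V y - V x = variationOnFromTo f Set.univ x y := by
      rw [hV, ← variationOnFromTo.add hb.locallyBoundedVariationOn (Set.mem_univ 0) (Set.mem_univ x)
        (Set.mem_univ y)]; ring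
    rw [e, variationOnFromTo.eq_of_le _ _ h, dist_edist]
    apply ENNReal.toReal_mono
    · exact (lt_of_le_of_lt (eVariationOn.mono f Set.inter_subset_left) (lt_top_iff_ne_top.2 hb)).ne
    · exact eVariationOn.edist_le f ⟨Set.mem_univ _, le_rfl, h⟩ ⟨Set.mem_univ _, h, le_rfl⟩
  have hd : ∀ x y : I, dist (f x) (f y) ≤ |V x - V y| := by
    intro x y
    rcases le_total x y with h | h
    · rw [abs_sub_comm]; exact (hd' x y h).trans (le_abs_self _)
    · rw [dist_comm]; exact (hd' y x h).trans (le_abs_self _)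
  rcases eq_or_lt_of_le hL0 with h0 | hpos
  · refine ⟨p, Path.Homotopic.refl p, le_rfl, fun s t => ?_⟩
    rw [← h0, zero_mul]
    have h1 : V s = 0 := le_antisymm (by rw [h0, ← hV1]; exact hmono s.2.2) (by rw [← hV0]; exact hmono s.2.1)
    have h2 : V t = 0 := le_antisymm (by rw [h0, ← hV1]; exact hmono t.2.2) (by rw [← hV0]; exact hmono t.2.1)
    have := hd s t
    rw [h1, h2] at this; simpa using this
  have hsurj : ∀ s : I, ∃ t : I, V t = L * s.1 := by
    intro s
    have := mem_range_of_exists_le_of_exists_ge hVc (c := L * s.1)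
      ⟨0, by rw [hV0]; exact mul_nonneg hL0 s.2.1⟩ ⟨1, by rw [hV1]; nlinarith [s.2.2]⟩
    exact this
  choose g hg using hsurj
  have hlip : ∀ s t : I, dist (f (g s)) (f (g t)) ≤ L * |s.1 - t.1| := by
    intro s t
    refine (hd _ _).trans (le_of_eq ?_)
    rw [hg, hg, ← mul_sub, abs_mul, abs_of_nonneg hL0]
  have hz : ∀ x y : I, V x = V y → p x = p y := by
    intro x y h
    have := hd x y
    rw [h, sub_self, abs_zero] at this
    exact Subtype.ext (dist_le_zero.1 this)
  have hcont : Continuous fun s : I => f (g s) := by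
    have : LipschitzWith L.toNNReal fun s : I => f (g s) := by
      apply LipschitzWith.of_dist_le_mul
      intro s t
      rw [Real.coe_toNNReal _ hL0]
      exact hlip s t
    exact this.continuous
  let q : Path a b :=
    { toFun := fun s => p (g s)
      continuous_toFun := continuous_induced_rng.2 hcont
      source' := by
        rw [hz (g 0) 0 (by rw [hg, hV0]; simp)]; simp
      target' := by
        rw [hz (g 1) 1 (by rw [hg, hV1]; simp)]; simp }
  have hqlip : ∀ s t : I, dist (q s : E2) (q t) ≤ L * |s.1 - t.1| := hlip
  refine ⟨q, ?_, ?_, hqlip⟩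
  · have hmem : ∀ t, V t / L ∈ Set.Icc (0:ℝ) 1 := by
      intro t
      constructor
      · apply div_nonneg _ hL0; rw [← hV0]; exact hmono t.2.1
      · rw [div_le_one hpos, ← hV1]; exact hmono t.2.2
    let φ : I → I := fun t => ⟨V t / L, hmem t⟩
    have hφ : Continuous φ := Continuous.subtype_mk (hVc.div_const _) _
    have h0 : φ 0 = 0 := Subtype.ext (by show V 0 / L = 0; rw [hV0]; simp)
    have h1 : φ 1 = 1 := Subtype.ext (by show V 1 / L = 1; rw [hV1]; exact div_self hpos.ne')
    have e : q.reparam φ hφ h0 h1 = p := by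
      ext t
      show (p (g (φ t)) : E2) _ = _
      rw [hz (g (φ t)) t]
      rw [hg]; show L * (V t / L) = _; field_simp
    have := (⟨Path.Homotopy.reparam q φ hφ h0 h1⟩ : q.Homotopic _)
    rw [e] at this
    exact Path.Homotopic.symm this
  · refine (cost_le_of_lip q hL0 hqlip).trans ?_
    rw [hL, ENNReal.ofReal_toReal hp]

end THPP
end
section
namespace THPP
set_option linter.all false
local notation "I" => unitInterval
open Filter Topology
variable {X : Set E2}

def LocCone (C : Set E2) (p : E2) : Prop :=
  ∀ᶠ v in 𝓝 (0:E2), ∀ t ∈ Set.Ioc (0:ℝ) 1, (p + v ∈ C ↔ p + t • v ∈ C)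

lemma LocCone.iUnion {ι : Type*} [Finite ι] {C : ι → Set E2} {p : E2} (h : ∀ i, LocCone (C i) p) :
    LocCone (⋃ i, C i) p := by
  have := eventually_all.2 h
  filter_upwards [this] with v hv t ht
  simp only [Set.mem_iUnion]
  exact exists_congr fun i => hv i t ht

lemma LocCone.biUnion {ι : Type*} {s : Set ι} (hs : s.Finite) {C : ι → Set E2} {p : E2}
    (h : ∀ i ∈ s, LocCone (C i) p) : LocCone (⋃ i ∈ s, C i) p := by
  have := (eventually_all_finite hs).2 h
  filter_upwards [this] with v hv t ht
  simp only [Set.mem_iUnion]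
  exact exists_congr fun i => exists_congr fun hi => hv i hi t ht

lemma LocCone.iInter {ι : Type*} [Finite ι] {C : ι → Set E2} {p : E2} (h : ∀ i, LocCone (C i) p) :
    LocCone (⋂ i, C i) p := by
  have := eventually_all.2 h
  filter_upwards [this] with v hv t ht
  simp only [Set.mem_iInter]
  exact forall_congr' fun i => hv i t ht

lemma locCone_nonneg (f : E2 →ᵃ[ℝ] ℝ) (p : E2) : LocCone {x | 0 ≤ f x} p := by
  have hf : Continuous f := f.continuous_of_finiteDimensional
  have hlin : ∀ v, f (p + v) = f p + f.linear v := by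
    intro v; rw [add_comm p v, ← vadd_eq_add, f.map_vadd]; simp [add_comm]
  have hl : Tendsto f.linear (𝓝 0) (𝓝 0) := by
    have := (f.linear.continuous_of_finiteDimensional).tendsto 0
    simpa using this
  rcases lt_trichotomy (f p) 0 with h | h | h
  · filter_upwards [hl.eventually_lt_const (show (0:ℝ) < -f p by linarith)] with v hv t ht
    simp only [Set.mem_ofPred_eq, hlin, map_smul, smul_eq_mul]
    have : t * f.linear v < - f p := by
      rcases le_total 0 (f.linear v) with h0 | h0
      · nlinarith [ht.1, ht.2]
      · nlinarith [ht.1, ht.2]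
    constructor <;> intro <;> linarith
  · refine Eventually.of_forall fun v t ht => ?_
    simp only [Set.mem_ofPred_eq, hlin, map_smul, smul_eq_mul, h, zero_add]
    exact ⟨fun h => mul_nonneg ht.1.le h, fun h => nonneg_of_mul_nonneg_right h ht.1⟩
  · filter_upwards [hl.eventually_const_lt (show -f p < (0:ℝ) by linarith)] with v hv t ht
    simp only [Set.mem_ofPred_eq, hlin, map_smul, smul_eq_mul]
    have : -f p < t * f.linear v := by
      rcases le_total 0 (f.linear v) with h0 | h0
      · nlinarith [ht.1, ht.2, mul_nonneg ht.1.le h0]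
      · nlinarith [ht.1, ht.2]
    constructor <;> intro <;> linarith

lemma locCone_simplex (s : Finset E2) (hs : AffineIndependent ℝ ((↑) : s → E2)) (p : E2) :
    LocCone (convexHull ℝ (↑s : Set E2)) p := by
  obtain ⟨t, hst, hti, htop⟩ := exists_subset_affineIndependent_affineSpan_eq_top (k := ℝ)
    (s := (↑s : Set E2)) hs
  let b : AffineBasis t ℝ E2 := ⟨(↑), hti, by simpa using htop⟩
  haveI : Finite t := finite_set_of_fin_dim_affineIndependent ℝ hti
  haveI := Fintype.ofFinite t
  have key : convexHull ℝ (↑s : Set E2) =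
      (⋂ i : t, {x | 0 ≤ b.coord i x}) ∩ (⋂ i : {i : t // i.1 ∉ s}, {x | 0 ≤ (-b.coord i.1) x}) := by
    apply subset_antisymm
    · apply convexHull_min
      · intro x hx
        have hx' : x = b ⟨x, hst hx⟩ := rfl
        simp only [Set.mem_inter_iff, Set.mem_iInter, Set.mem_ofPred_eq]
        constructor
        · intro i; rw [hx', b.coord_apply]; split_ifs <;> norm_num
        · rintro ⟨i, hi⟩
          show 0 ≤ -(b.coord i x)
          rw [hx', b.coord_apply_ne]; · simp
          rintro rfl; exact hi hx
      · apply Convex.inter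
        · exact convex_iInter fun i => (convex_Ici (0:ℝ)).affine_preimage (b.coord i)
        · exact convex_iInter fun i => (convex_Ici (0:ℝ)).affine_preimage (-b.coord i.1)
    · rintro x ⟨h1, h2⟩
      simp only [Set.mem_iInter, Set.mem_ofPred_eq] at h1 h2
      have hz : ∀ i : t, i.1 ∉ s → b.coord i x = 0 := by
        intro i hi
        have h2' : 0 ≤ -(b.coord i x) := h2 ⟨i, hi⟩
        linarith [h1 i]
      have hx := b.linear_combination_coord_eq_self x
      rw [← hx]
      classical
      have hs1 := b.sum_coord_apply_eq_one x
      have e : ∑ i, b.coord i x • b i = ∑ i ∈ Finset.univ.filter (fun i : t => i.1 ∈ s), b.coord i x • b i := by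
        symm; apply Finset.sum_filter_of_ne
        intro i _ h; by_contra hi; exact h (by rw [hz i hi, zero_smul])
      rw [e]
      apply (convex_convexHull ℝ _).sum_mem
      · intro i _; exact h1 i
      · rw [← hs1]; apply Finset.sum_filter_of_ne
        intro i _ h; by_contra hi; exact h (hz i hi)
      · intro i hi
        have hi' : i.1 ∈ s := by simpa using hi
        exact subset_convexHull ℝ _ (show b i ∈ (↑s : Set E2) from hi')
  rw [key]
  have := (LocCone.iInter fun i : t => locCone_nonneg (b.coord i) p)
  have h2 := (LocCone.iInter fun i : {i : t // i.1 ∉ s} => locCone_nonneg (-b.coord i.1) p)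
  filter_upwards [this, h2] with v h1 h2 t ht
  exact and_congr (h1 t ht) (h2 t ht)

lemma locCone_poly (hpoly : ∃ (n : ℕ) (P : Fin n → Finset E2), X = ⋃ i, convexHull ℝ (↑(P i) : Set E2))
    (p : E2) : LocCone X p := by
  obtain ⟨n, P, rfl⟩ := hpoly
  apply LocCone.iUnion
  intro i
  rw [convexHull_eq_union]
  have e : (⋃ (t : Finset E2) (_ : (↑t : Set E2) ⊆ ↑(P i)) (_ : AffineIndependent ℝ ((↑) : t → E2)),
    convexHull ℝ (↑t : Set E2)) = ⋃ t ∈ {t : Finset E2 | t ⊆ P i ∧ AffineIndependent ℝ ((↑) : t → E2)},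
      convexHull ℝ (↑t : Set E2) := by
    ext x; simp only [Set.mem_iUnion, Set.mem_ofPred_eq, Finset.coe_subset, exists_prop, and_assoc]
  rw [e]
  apply LocCone.biUnion
  · exact (P i).powerset.finite_toSet.subset fun t ht => by simpa using ht.1
  · intro t ht; exact locCone_simplex t ht.2 p

/-- explicit chart -/
def IsChart (X : Set E2) (p : E2) (R : ℝ) : Prop :=
  0 < R ∧ p ∈ X ∧ ∀ v, ‖v‖ < R → ∀ t : ℝ, 0 < t → t ≤ 1 → (p + v ∈ X ↔ p + t • v ∈ X)

lemma exists_chart (hpoly : ∃ (n : ℕ) (P : Fin n → Finset E2), X = ⋃ i, convexHull ℝ (↑(P i) : Set E2))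
    {p : E2} (hp : p ∈ X) : ∃ R, IsChart X p R := by
  have := locCone_poly hpoly p
  obtain ⟨R, hR, h⟩ := Metric.eventually_nhds_iff.1 this
  exact ⟨R, hR, hp, fun v hv t h0 h1 => h (by simpa using hv) t ⟨h0, h1⟩⟩

end THPP
end
section
namespace THPP
set_option linter.all false
local notation "I" => unitInterval
open Filter Topology
variable {X : Set E2}

lemma cost_linePath_le {x y : E2} (hx : x ∈ X) (hy : y ∈ X) (h : segment ℝ x y ⊆ X) :
    cost (linePath hx hy h) ≤ ENNReal.ofReal ‖x - y‖ := by
  apply cost_le_of_lip _ (norm_nonneg _)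
  intro s t
  show dist ((1 - s.1) • x + s.1 • y) ((1 - t.1) • x + t.1 • y) ≤ _
  rw [dist_eq_norm, show (1 - s.1) • x + s.1 • y - ((1 - t.1) • x + t.1 • y) = (t.1 - s.1) • (x - y) by
    module, norm_smul, mul_comm, Real.norm_eq_abs, abs_sub_comm]

def D (y z : X) : ENNReal := ⨅ p : Path y z, cost p
def d (y z : X) : ℝ := (D y z).toReal

lemma D_self (y : X) : D y y = 0 := le_antisymm (iInf_le_of_le (Path.refl y) (cost_refl y).le) bot_le
lemma D_comm (y z : X) : D y z = D z y := by
  apply le_antisymm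
  · exact le_iInf fun p => iInf_le_of_le p.symm (cost_symm p).le
  · exact le_iInf fun p => iInf_le_of_le p.symm (cost_symm p).le
lemma D_tri (x y z : X) : D x z ≤ D x y + D y z := by
  unfold D
  rw [ENNReal.iInf_add]
  refine le_iInf fun r => ?_
  rw [ENNReal.add_iInf]
  refine le_iInf fun r' => ?_
  rw [← cost_trans]
  exact iInf_le _ _
lemma D_le {y z : X} (p : Path y z) : D y z ≤ cost p := iInf_le _ _
lemma edist_le_D (y z : X) : edist (y:E2) z ≤ D y z := le_iInf fun p => by
  have := edist_le_cost p 0 1; simpa using this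

lemma D_seg (y z : X) (h : segment ℝ (y:E2) z ⊆ X) : D y z ≤ ENNReal.ofReal (dist (y:E2) z) := by
  rw [dist_eq_norm]
  exact (D_le (linePath y.2 z.2 h)).trans (cost_linePath_le _ _ _)

lemma IsChart.star {p : E2} {R : ℝ} (h : IsChart X p R) {z : E2} (hz : z ∈ X) (hd : dist z p < R) :
    segment ℝ p z ⊆ X := by
  rw [segment_eq_image']
  rintro _ ⟨t, ⟨h0, h1⟩, rfl⟩
  rcases eq_or_lt_of_le h0 with h0 | h0
  · subst h0; simpa using h.2.1
  · exact (h.2.2 (z - p) (by rwa [← dist_eq_norm]) t h0 h1).1 (by simpa using hz)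

structure Good (X : Set E2) : Prop where
  cpt : IsCompact X
  pc : IsPathConnected X
  chart : ∀ p ∈ X, ∃ R, IsChart X p R

namespace Good
variable (hX : Good X)
include hX

lemma D_ne_top (y z : X) : D y z ≠ ⊤ := by
  haveI : PathConnectedSpace X := isPathConnected_iff_pathConnectedSpace.1 hX.pc
  have hloc : ∀ c : X, ∀ᶠ z in 𝓝 c, D c z ≠ ⊤ := by
    intro c
    obtain ⟨R, hR⟩ := hX.chart c c.2
    filter_upwards [Metric.ball_mem_nhds c hR.1] with z hz
    exact ((D_seg c z (hR.star z.2 hz)).trans_lt ENNReal.ofReal_lt_top).ne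
  have hcl : IsClopen {z | D y z ≠ ⊤} := by
    constructor
    · rw [← isOpen_compl_iff, isOpen_iff_mem_nhds]
      intro c hc
      have hc' : D y c = ⊤ := by simpa using hc
      filter_upwards [hloc c] with z hz
      simp only [Set.mem_compl_iff, Set.mem_ofPred_eq, not_not]
      by_contra h
      have := D_tri y z c
      rw [hc', D_comm z c] at this
      exact (ENNReal.add_ne_top.2 ⟨h, hz⟩) (top_le_iff.1 this)
    · rw [isOpen_iff_mem_nhds]
      intro c hc
      filter_upwards [hloc c] with z hz
      exact ne_top_of_le_ne_top (ENNReal.add_ne_top.2 ⟨hc, hz⟩) (D_tri y c z)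
  have := hcl.eq_univ ⟨y, by simp [D_self]⟩
  have h2 : z ∈ {z | D y z ≠ ⊤} := by rw [this]; trivial
  exact h2

lemma ofReal_d (y z : X) : ENNReal.ofReal (d y z) = D y z := ENNReal.ofReal_toReal (hX.D_ne_top y z)
lemma d_tri (x y z : X) : d x z ≤ d x y + d y z := by
  unfold d
  rw [← ENNReal.toReal_add (hX.D_ne_top _ _) (hX.D_ne_top _ _)]
  exact ENNReal.toReal_mono (ENNReal.add_ne_top.2 ⟨hX.D_ne_top _ _, hX.D_ne_top _ _⟩) (D_tri _ _ _)
lemma dist_le_d (y z : X) : dist (y:E2) z ≤ d y z := by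
  rw [dist_edist]; exact ENNReal.toReal_mono (hX.D_ne_top _ _) (edist_le_D y z)
lemma eq_of_d {y z : X} (h : d y z ≤ 0) : y = z := 
  Subtype.ext (dist_le_zero.1 ((hX.dist_le_d y z).trans h))
lemma exists_path (y z : X) {ε : ℝ} (hε : 0 < ε) : ∃ p : Path y z, cost p ≤ ENNReal.ofReal (d y z + ε) := by
  have : D y z < ENNReal.ofReal (d y z + ε) := by
    rw [← hX.ofReal_d]; rw [ENNReal.ofReal_lt_ofReal_iff_of_nonneg]; linarith
    exact ENNReal.toReal_nonneg
  obtain ⟨p, hp⟩ := iInf_lt_iff.1 this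
  exact ⟨p, hp.le⟩
omit hX in
lemma d_le_of {y z : X} (p : Path y z) {K : ℝ} (hK : 0 ≤ K) (h : cost p ≤ ENNReal.ofReal K) : d y z ≤ K :=
  ENNReal.toReal_le_of_le_ofReal hK ((D_le p).trans h)
lemma le_d_of {y z : X} {K : ℝ} (h : ∀ p : Path y z, ENNReal.ofReal K ≤ cost p) : K ≤ d y z := by
  have : ENNReal.ofReal K ≤ D y z := le_iInf h
  rw [← hX.ofReal_d] at this
  exact (ENNReal.ofReal_le_ofReal_iff ENNReal.toReal_nonneg).1 this

/-- Lebesgue number for charts -/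
lemma leb (f : X → ℝ) (hf : ∀ c, 0 < f c) : ∃ δ > 0, ∀ x : X, ∃ c : X, ∀ y : X, dist (y:E2) x < δ → dist (y:E2) c < f c := by
  obtain ⟨δ, hδ, h⟩ := lebesgue_number_lemma_of_metric (s := X) hX.cpt (c := fun c : X => Metric.ball (c:E2) (f c))
    (fun _ => Metric.isOpen_ball) (fun x hx => Set.mem_iUnion.2 ⟨⟨x, hx⟩, Metric.mem_ball_self (hf _)⟩)
  exact ⟨δ, hδ, fun x => (h x x.2).imp fun c hc y hy => hc hy⟩

lemma m2 {ε : ℝ} (hε : 0 < ε) : ∃ η > 0, ∀ y z : X, dist (y:E2) z < η → d y z < ε := by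
  choose R hR using fun c : X => hX.chart c c.2
  obtain ⟨η, hη, h⟩ := hX.leb (fun c => min (R c) (ε/2)) (fun c => lt_min (hR c).1 (by linarith))
  refine ⟨η, hη, fun y z hyz => ?_⟩
  obtain ⟨c, hc⟩ := h z
  have key : ∀ w : X, dist (w:E2) z < η → d c w < ε/2 := by
    intro w hw
    have h1 := hc w hw
    have h2 := D_seg c w ((hR c).star w.2 (h1.trans_le (min_le_left _ _)))
    have h3 : d c w ≤ dist (c:E2) w := ENNReal.toReal_le_of_le_ofReal dist_nonneg h2
    rw [dist_comm] at h3
    exact h3.trans_lt (h1.trans_le (min_le_right _ _))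
  have h1 := key y hyz
  have h2 := key z (by simpa using hη)
  have := hX.d_tri y c z
  rw [show d y c = d c y by unfold d; rw [D_comm]] at this
  linarith

lemma lsc : ∃ δ > 0, ∀ (c y z : X) (p q : Path y z), (∀ t, dist (p t : E2) c < δ) →
    (∀ t, dist (q t : E2) c < δ) → p.Homotopic q := by
  choose R hR using fun c : X => hX.chart c c.2
  obtain ⟨δ, hδ, h⟩ := hX.leb R (fun c => (hR c).1)
  refine ⟨δ, hδ, fun c y z p q hp hq => ?_⟩
  obtain ⟨e, he⟩ := h c
  let S : Set E2 := X ∩ Metric.ball (e:E2) (R e)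
  have hS : StarConvex ℝ (e:E2) S := by
    rw [starConvex_iff_segment_subset]
    intro w hw
    refine Set.subset_inter ((hR e).star hw.1 hw.2) ?_
    exact (convex_ball _ _).segment_subset (Metric.mem_ball_self (hR e).1) hw.2
  haveI := hS.contractibleSpace ⟨e, e.2, Metric.mem_ball_self (hR e).1⟩
  let lift : (r : Path y z) → (∀ t, dist (r t : E2) c < δ) → 
     Path (⟨y, y.2, he y (by have := hp 0; simpa using this)⟩ : S) 
      (⟨z, z.2, he z (by have := hp 1; simpa using this)⟩ : S) := fun r hr =>
    { toFun := fun t => ⟨r t, (r t).2, he _ (hr t)⟩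
      continuous_toFun := Continuous.subtype_mk (continuous_subtype_val.comp r.continuous) _
      source' := Subtype.ext (by simp)
      target' := Subtype.ext (by simp) }
  have H := SimplyConnectedSpace.paths_homotopic (lift p hp) (lift q hq)
  let ι : C(S, X) := ⟨fun s => ⟨s.1, s.2.1⟩, Continuous.subtype_mk continuous_subtype_val _⟩
  have := H.map ι
  exact this

end Good

lemma d_comm (y z : X) : d y z = d z y := by unfold d; rw [D_comm]
lemma d_self (y : X) : d y y = 0 := by unfold d; rw [D_self]; rfl
lemma d_nonneg (y z : X) : 0 ≤ d y z := ENNReal.toReal_nonneg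

end THPP
end
section
namespace THPP
set_option linter.all false
local notation "I" => unitInterval
open Filter Topology
open scoped InnerProductSpace
variable {X : Set E2}

/-- conic set near zero -/
structure Cn (C : Set E2) (R : ℝ) : Prop where
  zero : (0:E2) ∈ C
  iff : ∀ v : E2, ‖v‖ < R → ∀ t : ℝ, 0 < t → t ≤ 1 → (v ∈ C ↔ t • v ∈ C)

def Vis (C : Set E2) (y z : E2) : Prop := segment ℝ y z ⊆ C

lemma Vis.symm {C : Set E2} {y z : E2} (h : Vis C y z) : Vis C z y := by
  unfold Vis; rw [segment_symm]; exact h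
lemma Vis.left {C : Set E2} {y z : E2} (h : Vis C y z) : y ∈ C := h (left_mem_segment ℝ y z)
lemma Vis.right {C : Set E2} {y z : E2} (h : Vis C y z) : z ∈ C := h (right_mem_segment ℝ y z)

lemma norm_lt_of_seg {y z w : E2} {R : ℝ} (hy : ‖y‖ < R) (hz : ‖z‖ < R) (hw : w ∈ segment ℝ y z) : ‖w‖ < R := by
  have := (convex_ball (0:E2) R).segment_subset (x := y) (y := z) (by simpa using hy) (by simpa using hz) hw
  simpa using this

def ell (w u : E2) : ℝ := w 0 * u 1 - w 1 * u 0

lemma ell_add (w u v : E2) : ell w (u + v) = ell w u + ell w v := by simp [ell]; ring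
lemma ell_smul (w u : E2) (c : ℝ) : ell w (c • u) = c * ell w u := by simp [ell]; ring
lemma ell_self (w : E2) : ell w w = 0 := by simp [ell]; ring

lemma ell_zero {w u : E2} (hw : w ≠ 0) (h : ell w u = 0) : ∃ c : ℝ, u = c • w := by
  have hn : w 0 ^ 2 + w 1 ^ 2 ≠ 0 := by
    intro h0
    apply hw
    have h00 : w 0 = 0 := by nlinarith [sq_nonneg (w 0), sq_nonneg (w 1)]
    have h11 : w 1 = 0 := by nlinarith [sq_nonneg (w 0), sq_nonneg (w 1)]
    ext i; fin_cases i <;> simp [h00, h11]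
  unfold ell at h
  refine ⟨(w 0 * u 0 + w 1 * u 1) / (w 0 ^ 2 + w 1 ^ 2), ?_⟩
  ext i
  fin_cases i
  · simp; field_simp; linear_combination (-w 1) * h
  · simp; field_simp; linear_combination (w 0) * h

lemma ell_continuous (w : E2) : Continuous (ell w) := by unfold ell; fun_prop

lemma obstruct {C : Set E2} {R : ℝ} (hC : Cn C R) {y z : E2} (hy : y ∈ C) (hz : z ∈ C)
    (hyR : ‖y‖ < R) (hzR : ‖z‖ < R) (hv : ¬ Vis C y z) :
    ∃ w : E2, w ≠ 0 ∧ 0 ≤ ⟪w, ‖z‖ • y + ‖y‖ • z⟫_ℝ ∧ ell w y * ell w z < 0 ∧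
      ∀ c : ℝ, ‖c • w‖ < R → c • w ∈ C → c ≤ 0 := by
  unfold Vis at hv
  obtain ⟨w, hw, hwC⟩ := Set.not_subset.1 hv
  have hwR := norm_lt_of_seg hyR hzR hw
  have hw0 : w ≠ 0 := by rintro rfl; exact hwC hC.zero
  have hray : ∀ c : ℝ, ‖c • w‖ < R → c • w ∈ C → c ≤ 0 := by
    intro c hc hcC
    by_contra hpos
    push Not at hpos
    rcases le_total c 1 with h1 | h1
    · exact hwC ((hC.iff w hwR c hpos h1).2 hcC)
    · have := (hC.iff _ hc c⁻¹ (by positivity) (inv_le_one_of_one_le₀ h1)).1 hcC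
      rw [smul_smul, inv_mul_cancel₀ hpos.ne', one_smul] at this
      exact hwC this
  obtain ⟨a, b, ha, hb, hab, rfl⟩ := hw
  set w := a • y + b • z with hwdef
  have ha' : 0 < a := by
    refine lt_of_le_of_ne ha fun h => hwC ?_
    have : b = 1 := by linarith
    rw [hwdef, ← h, this]; simpa using hz
  have hb' : 0 < b := by
    refine lt_of_le_of_ne hb fun h => hwC ?_
    have : a = 1 := by linarith
    rw [hwdef, ← h, this]; simpa using hy
  have hl : a * ell w y + b * ell w z = 0 := by
    rw [← ell_smul, ← ell_smul, ← ell_add, ← hwdef, ell_self]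
  have hyne : ell w y ≠ 0 := by
    intro h0
    have h1 : ell w z = 0 := by
      rw [h0] at hl
      have : b * ell w z = 0 := by linarith
      exact (mul_eq_zero.1 this).resolve_left hb'.ne'
    obtain ⟨α, hα⟩ := ell_zero hw0 h0
    obtain ⟨β, hβ⟩ := ell_zero hw0 h1
    have hα0 := hray α (by rw [← hα]; exact hyR) (by rw [← hα]; exact hy)
    have hβ0 := hray β (by rw [← hβ]; exact hzR) (by rw [← hβ]; exact hz)
    have e : (a * α + b * β) • w = w := by
      rw [add_smul, mul_smul, mul_smul, ← hα, ← hβ]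
    have e2 : (a * α + b * β - 1) • w = 0 := by rw [sub_smul, e]; simp
    rcases smul_eq_zero.1 e2 with h | h
    · nlinarith
    · exact hw0 h
  refine ⟨w, hw0, ?_, ?_, hray⟩
  · rw [hwdef]
    simp only [inner_add_left, inner_add_right, real_inner_smul_left, real_inner_smul_right,
      real_inner_self_eq_norm_sq, real_inner_comm y z]
    have := real_inner_comm y z
    have hcs := abs_real_inner_le_norm y z
    rw [abs_le] at hcs
    rw [real_inner_comm y z] at *
    have h1 : 0 ≤ ‖y‖ * (‖y‖ * ‖z‖ + ⟪y, z⟫_ℝ) := mul_nonneg (norm_nonneg _) (by linarith)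
    have h2 : 0 ≤ ‖z‖ * (‖y‖ * ‖z‖ + ⟪y, z⟫_ℝ) := mul_nonneg (norm_nonneg _) (by linarith)
    nlinarith [mul_nonneg ha h1, mul_nonneg hb h2]
  · have : 0 < a * (ell w y)^2 := by positivity
    have e : b * (ell w y * ell w z) = - (a * (ell w y)^2) := by linear_combination (ell w y) * hl
    by_contra h; push Not at h
    nlinarith [mul_nonneg hb h]

/-- crossing step of the Vis-lemma -/
lemma cross {C : Set E2} {R : ℝ} {x y w b : E2} (hw0 : w ≠ 0) (hwb : 0 ≤ ⟪w, b⟫_ℝ)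
    (hray : ∀ c : ℝ, ‖c • w‖ < R → c • w ∈ C → c ≤ 0) (hxR : ‖x‖ < R) (hyR : ‖y‖ < R)
    (hv : Vis C x y) (hy : ell w y ≠ 0) (hs : ell w x * ell w y ≤ 0) (hyb : 0 ≤ ⟪y, b⟫_ℝ) :
    ⟪x, b⟫_ℝ ≤ 0 := by
  set k := ell w y - ell w x with hk
  have hk0 : k ≠ 0 := by
    intro h
    have : ell w x = ell w y := by linarith
    rw [this] at hs
    exact hy (by nlinarith)
  have hμ : 0 < ell w y / k := by
    have : 0 < ell w y * k := by rw [hk]; nlinarith [sq_nonneg (ell w y), pow_pos (abs_pos.2 hy) 2, sq_abs (ell w y)]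
    have h2 : ell w y / k = (ell w y * k) / k^2 := by field_simp
    rw [h2]; positivity
  have hν : 0 ≤ -ell w x / k := by
    have : 0 ≤ -ell w x * k := by rw [hk]; nlinarith [sq_nonneg (ell w x)]
    have h2 : -ell w x / k = (-ell w x * k) / k^2 := by field_simp
    rw [h2]; positivity
  have hsum : ell w y / k + -ell w x / k = 1 := by field_simp; rw [hk]; ring
  set u := (ell w y / k) • x + (-ell w x / k) • y with hu
  have huseg : u ∈ segment ℝ x y := ⟨_, _, hμ.le, hν, hsum, rfl⟩
  have hu0 : ell w u = 0 := by rw [hu, ell_add, ell_smul, ell_smul]; ring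
  obtain ⟨c, hc⟩ := ell_zero hw0 hu0
  have hc0 := hray c (by rw [← hc]; exact norm_lt_of_seg hxR hyR huseg) (by rw [← hc]; exact hv huseg)
  have e : ⟪u, b⟫_ℝ ≤ 0 := by rw [hc, real_inner_smul_left]; nlinarith
  rw [hu, inner_add_left, real_inner_smul_left, real_inner_smul_left] at e
  by_contra h; push Not at h
  nlinarith [mul_pos hμ h, mul_nonneg hν hyb]

lemma b_nonneg (y z : E2) : 0 ≤ ⟪y, ‖z‖ • y + ‖y‖ • z⟫_ℝ := by
  rw [inner_add_right, real_inner_smul_right, real_inner_smul_right, real_inner_self_eq_norm_sq]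
  have hcs := abs_real_inner_le_norm y z
  rw [abs_le] at hcs
  nlinarith [norm_nonneg y]

lemma vis_lemma {C : Set E2} {R : ℝ} (hC : Cn C R) {x y z : E2} 
    (hxR : ‖x‖ < R) (hyR : ‖y‖ < R) (hzR : ‖z‖ < R) (hxy : Vis C x y) (hxz : Vis C x z) (hv : ¬ Vis C y z) :
    ‖z‖ * ⟪x, y⟫_ℝ + ‖y‖ * ⟪x, z⟫_ℝ ≤ 0 := by
  obtain ⟨w, hw0, hwb, hop, hray⟩ := obstruct hC hxy.right hxz.right hyR hzR hv
  have hy0 : ell w y ≠ 0 := fun h => by simp [h] at hop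
  have hz0 : ell w z ≠ 0 := fun h => by simp [h] at hop
  have e : ‖z‖ * ⟪x, y⟫_ℝ + ‖y‖ * ⟪x, z⟫_ℝ = ⟪x, ‖z‖ • y + ‖y‖ • z⟫_ℝ := by
    rw [inner_add_right, real_inner_smul_right, real_inner_smul_right]
  rw [e]
  rcases le_total (ell w x * ell w y) 0 with h | h
  · exact cross hw0 hwb hray hxR hyR hxy hy0 h (b_nonneg y z)
  · refine cross hw0 hwb hray hxR hzR hxz hz0 ?_ (by rw [add_comm]; exact b_nonneg z y)
    have hy2 : 0 < (ell w y)^2 := by positivity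
    have : (ell w x * ell w z) * (ell w y)^2 = (ell w x * ell w y) * (ell w y * ell w z) := by ring
    by_contra hh; push Not at hh
    nlinarith [mul_pos hh hy2, mul_nonneg h (neg_nonneg.2 hop.le)]

lemma detour {y z w : E2} (hy : y ≠ 0) (hz : z ≠ 0) {c : ℝ} (hc : c ≤ 0)
    (hwb : 0 ≤ ⟪w, ‖z‖ • y + ‖y‖ • z⟫_ℝ) : ‖y‖ + ‖z‖ ≤ ‖y - c • w‖ + ‖z - c • w‖ := by
  have hy' := norm_pos_iff.2 hy
  have hz' := norm_pos_iff.2 hz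
  have h1 := real_inner_le_norm (y - c • w) y
  have h2 := real_inner_le_norm (z - c • w) z
  rw [inner_sub_left, real_inner_smul_left, real_inner_self_eq_norm_sq] at h1 h2
  rw [inner_add_right, real_inner_smul_right, real_inner_smul_right] at hwb
  have h1' := mul_le_mul_of_nonneg_left h1 hz'.le
  have h2' := mul_le_mul_of_nonneg_left h2 hy'.le
  have h3 := mul_nonneg (neg_nonneg.2 hc) hwb
  have : (‖y‖ * ‖z‖) * (‖y‖ + ‖z‖) ≤ (‖y‖ * ‖z‖) * (‖y - c • w‖ + ‖z - c • w‖) := by nlinarith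
  exact le_of_mul_le_mul_left this (by positivity)

def loc (X : Set E2) (p : E2) : Set E2 := {v | p + v ∈ X}

lemma IsChart.cn {p : E2} {R : ℝ} (h : IsChart X p R) : Cn (loc X p) R :=
  ⟨by simpa [loc] using h.2.1, h.2.2⟩

lemma vis_loc {p y z : E2} : Vis (loc X p) (y - p) (z - p) ↔ segment ℝ y z ⊆ X := by
  have : segment ℝ y z = (fun v => p + v) '' segment ℝ (y - p) (z - p) := by
    rw [segment_translate_image]; simp
  rw [this, Set.image_subset_iff]; rfl

open Classical in
def dC (C : Set E2) (y z : E2) : ℝ := if Vis C y z then ‖y - z‖ else ‖y‖ + ‖z‖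

lemma Good.d_chart (hX : Good X) {p : E2} {R : ℝ} (h : IsChart X p R) (y z : X)
    (hy : dist (y:E2) p < R/2) (hz : dist (z:E2) p < R/2) : d y z = dC (loc X p) (y - p) (z - p) := by
  have hR := h.1
  unfold dC
  split_ifs with hv
  · rw [vis_loc] at hv
    apply le_antisymm
    · rw [show (y:E2) - p - (z - p) = y - z by abel, ← dist_eq_norm]
      exact ENNReal.toReal_le_of_le_ofReal dist_nonneg (D_seg y z hv)
    · rw [show (y:E2) - p - (z - p) = y - z by abel, ← dist_eq_norm]
      exact hX.dist_le_d y z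
  · apply le_antisymm
    · let c : X := ⟨p, h.2.1⟩
      have key : ∀ w : X, dist (w:E2) p < R / 2 → d c w ≤ ‖(w:E2) - p‖ := by
        intro w hw
        have := D_seg c w (h.star w.2 (by linarith))
        rw [← dist_eq_norm, dist_comm]
        exact ENNReal.toReal_le_of_le_ofReal dist_nonneg this
      have := hX.d_tri y c z
      rw [d_comm y c] at this
      linarith [key y hy, key z hz]
    · apply hX.le_d_of
      intro q
      have hyR : ‖(y:E2) - p‖ < R/2 := by rwa [← dist_eq_norm]
      have hzR : ‖(z:E2) - p‖ < R/2 := by rwa [← dist_eq_norm]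
      suffices hs : ∃ t : I, ‖(y:E2) - p‖ + ‖(z:E2) - p‖ ≤ dist (y:E2) (q t) + dist (q t : E2) z by
        obtain ⟨t, ht⟩ := hs
        refine le_trans ?_ (edist_add_le_cost q t)
        rw [edist_dist, edist_dist, ← ENNReal.ofReal_add dist_nonneg dist_nonneg]
        exact ENNReal.ofReal_le_ofReal ht
      by_cases hin : ∀ t : I, dist (q t : E2) p < R
      · obtain ⟨w, hw0, hwb, hop, hray⟩ := obstruct h.cn (y := y - p) (z := z - p) (by simp [loc]) (by simp [loc])
          (by linarith) (by linarith) hv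
        have hcont : Continuous fun t : I => ell w ((q t : E2) - p) :=
          (ell_continuous w).comp ((continuous_subtype_val.comp q.continuous).sub continuous_const)
        have hy0 : (y:E2) - p ≠ 0 := fun h => by rw [h] at hop; simp [ell] at hop
        have hz0 : (z:E2) - p ≠ 0 := fun h => by rw [h] at hop; simp [ell] at hop
        have : ∃ t : I, ell w ((q t : E2) - p) = 0 := by
          rcases mul_neg_iff.1 hop with ⟨h1, h2⟩ | ⟨h1, h2⟩
          · exact mem_range_of_exists_le_of_exists_ge hcont ⟨1, by simpa using h2.le⟩ ⟨0, by simpa using h1.le⟩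
          · exact mem_range_of_exists_le_of_exists_ge hcont ⟨0, by simpa using h1.le⟩ ⟨1, by simpa using h2.le⟩
        obtain ⟨t, ht⟩ := this
        obtain ⟨c, hc⟩ := ell_zero hw0 ht
        have hc0 := hray c (by rw [← hc, ← dist_eq_norm]; exact hin t) (by rw [← hc]; simp [loc])
        refine ⟨t, (detour hy0 hz0 hc0 hwb).trans (le_of_eq ?_)⟩
        rw [← hc, dist_comm (q t : E2), dist_eq_norm, dist_eq_norm]
        congr 2 <;> abel
      · push Not at hin
        obtain ⟨t, ht⟩ := hin
        refine ⟨t, ?_⟩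
        have h1 := dist_triangle (q t : E2) y p
        have h2 := dist_triangle (q t : E2) z p
        rw [dist_comm (q t : E2) y] at h1
        rw [← dist_eq_norm, ← dist_eq_norm]
        linarith

end THPP
end
section
namespace THPP
set_option linter.all false
local notation "I" => unitInterval
open Filter Topology
open scoped InnerProductSpace
variable {X : Set E2} {C : Set E2} {R : ℝ}

lemma dC_vis {y z : E2} (h : Vis C y z) : dC C y z = ‖y - z‖ := if_pos h
lemma dC_nvis {y z : E2} (h : ¬ Vis C y z) : dC C y z = ‖y‖ + ‖z‖ := if_neg h
lemma dC_comm (y z : E2) : dC C y z = dC C z y := by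
  by_cases h : Vis C y z
  · rw [dC_vis h, dC_vis h.symm, norm_sub_rev]
  · rw [dC_nvis h, dC_nvis (fun h' => h h'.symm), add_comm]
lemma norm_le_dC (y z : E2) : ‖y - z‖ ≤ dC C y z := by
  unfold dC; split_ifs; · exact le_rfl
  exact norm_sub_le _ _
lemma dC_le (y z : E2) : dC C y z ≤ ‖y‖ + ‖z‖ := by
  unfold dC; split_ifs; · exact norm_sub_le _ _
  exact le_rfl
lemma dC_nonneg (y z : E2) : 0 ≤ dC C y z := (norm_nonneg _).trans (norm_le_dC y z)

lemma Cn.vis_zero (hC : Cn C R) {x : E2} (hx : x ∈ C) (hR : ‖x‖ < R) : Vis C 0 x := by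
  unfold Vis
  rw [segment_eq_image']
  rintro _ ⟨t, ⟨h0, h1⟩, rfl⟩
  rcases eq_or_lt_of_le h0 with h0 | h0
  · subst h0; simpa using hC.zero
  · have := (hC.iff x hR t h0 h1).1 hx
    simpa using this

lemma Vis.sub {y z m : E2} (h : Vis C y z) (hm : m ∈ segment ℝ y z) : Vis C y m :=
  fun w hw => h ((convex_segment y z).segment_subset (left_mem_segment ℝ y z) hm hw)

lemma cn_A (hC : Cn C R) {y z x m : E2} (hyR : ‖y‖ < R) (hzR : ‖z‖ < R) (hv : Vis C y z)
    (hm : m = (1/2:ℝ) • y + (1/2:ℝ) • z) (hx : x ∈ C) (hxR : ‖x‖ < R) :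
    (dC C x m)^2 ≤ 1/2 * (dC C x y)^2 + 1/2 * (dC C x z)^2 - 1/4 * (dC C y z)^2 := by
  have hms : m ∈ segment ℝ y z := ⟨1/2, 1/2, by norm_num, by norm_num, by norm_num, hm.symm⟩
  have hmR := norm_lt_of_seg hyR hzR hms
  have hmy : Vis C y m := hv.sub hms
  have hmz : Vis C z m := hv.symm.sub (by rw [segment_symm]; exact hms)
  rw [dC_vis hv, norm_sub_sq_real]
  have hxmi : ⟪x, m⟫_ℝ = 1/2 * ⟪x, y⟫_ℝ + 1/2 * ⟪x, z⟫_ℝ := by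
    rw [hm, inner_add_right, real_inner_smul_right, real_inner_smul_right]
  have hmm : ‖m‖^2 = 1/4 * ‖y‖^2 + 1/4 * ‖z‖^2 + 1/2 * ⟪y, z⟫_ℝ := by
    rw [hm, norm_add_sq_real, norm_smul, norm_smul, real_inner_smul_left, real_inner_smul_right]
    norm_num; ring
  by_cases hxm : Vis C x m
  · rw [dC_vis hxm]
    have h1 : ‖x - y‖^2 ≤ (dC C x y)^2 := pow_le_pow_left₀ (norm_nonneg _) (norm_le_dC _ _) 2
    have h2 : ‖x - z‖^2 ≤ (dC C x z)^2 := pow_le_pow_left₀ (norm_nonneg _) (norm_le_dC _ _) 2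
    rw [norm_sub_sq_real] at h1 h2 ⊢
    rw [hxmi, hmm]
    linarith
  · have hm0 : m ≠ 0 := by
      rintro rfl; exact hxm (hC.vis_zero hx hxR).symm
    have hmpos := norm_pos_iff.2 hm0
    rw [dC_nvis hxm]
    have key : ∀ u : E2, ‖u‖ < R → Vis C u m → 
        ‖m‖ * (‖x‖^2 + ‖u‖^2) + 2 * ‖x‖ * ⟪m, u⟫_ℝ ≤ ‖m‖ * (dC C x u)^2 := by
      intro u huR hum
      by_cases hxu : Vis C x u
      · rw [dC_vis hxu, norm_sub_sq_real]
        have := vis_lemma hC huR hxR hmR hxu.symm hum hxm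
        rw [real_inner_comm, real_inner_comm m u] at this
        linarith
      · rw [dC_nvis hxu]
        have := real_inner_le_norm m u
        nlinarith [norm_nonneg x, mul_le_mul_of_nonneg_left this (norm_nonneg x)]
    have k1 := key y hyR hmy
    have k2 := key z hzR hmz
    have hs : ⟪m, y⟫_ℝ + ⟪m, z⟫_ℝ = 2 * ‖m‖^2 := by
      rw [← inner_add_right, ← real_inner_self_eq_norm_sq, ← real_inner_smul_right, hm]
      congr 1; module
    have e1 : ‖m‖ * (‖x‖ + ‖m‖)^2 ≤ ‖m‖ * (1/2 * (dC C x y)^2 + 1/2 * (dC C x z)^2 - 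
        1/4 * (‖y‖ ^ 2 - 2 * ⟪y, z⟫_ℝ + ‖z‖ ^ 2)) := by
      have e2 : ‖x‖ * ⟪m, y⟫_ℝ + ‖x‖ * ⟪m, z⟫_ℝ = ‖x‖ * (2 * ‖m‖^2) := by rw [← hs]; ring
      have e3 : ‖m‖ * ‖m‖^2 = ‖m‖ * (1/4 * ‖y‖^2 + 1/4 * ‖z‖^2 + 1/2 * ⟪y, z⟫_ℝ) := by rw [hmm]
      nlinarith
    exact le_of_mul_le_mul_left e1 hmpos

lemma cn_B (hC : Cn C R) {y z x m : E2} {τ : ℝ} (hy : y ∈ C) (hz : z ∈ C) 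
    (hyR : ‖y‖ < R) (hzR : ‖z‖ < R) (hv : ¬ Vis C y z) (hle : ‖z‖ ≤ ‖y‖)
    (hτ : 2 * τ * ‖y‖ = ‖y‖ - ‖z‖) (hτ0 : 0 ≤ τ) (hτ1 : τ ≤ 1)
    (hm : m = τ • y) (hx : x ∈ C) (hxR : ‖x‖ < R) :
    (dC C x m)^2 ≤ 1/2 * (dC C x y)^2 + 1/2 * (dC C x z)^2 - 1/4 * (dC C y z)^2 := by
  have hy0 : y ≠ 0 := by rintro rfl; exact hv (hC.vis_zero hz hzR)
  have hypos := norm_pos_iff.2 hy0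
  have hmn : ‖m‖ = (‖y‖ - ‖z‖)/2 := by
    rw [hm, norm_smul, Real.norm_eq_abs, abs_of_nonneg hτ0]; linarith
  have hmseg : m ∈ segment ℝ y 0 := ⟨τ, 1 - τ, hτ0, by linarith, by ring, by rw [hm]; simp⟩
  have hmR : ‖m‖ < R := by rw [hmn]; linarith [norm_nonneg z]
  have hym : Vis C y m := (hC.vis_zero hy hyR).symm.sub hmseg
  have hr := norm_nonneg x
  have hZ := norm_nonneg z
  have hub : (dC C x m)^2 ≤ (‖x‖ + (‖y‖ - ‖z‖)/2)^2 := by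
    apply pow_le_pow_left₀ (dC_nonneg _ _); rw [← hmn]; exact dC_le _ _
  have hxy := real_inner_le_norm x y
  have hxz := real_inner_le_norm x z
  rw [dC_nvis hv]
  by_cases vxy : Vis C x y
  · have hd : (dC C x m)^2 ≤ ‖x‖^2 - 2 * τ * ⟪x, y⟫_ℝ + ((‖y‖ - ‖z‖)/2)^2 := by
      by_cases vxm : Vis C x m
      · rw [dC_vis vxm, norm_sub_sq_real, hmn, hm, real_inner_smul_right]; linarith
      · refine hub.trans ?_
        have hm0 : m ≠ 0 := by
          rintro h; rw [h] at vxm; exact vxm (hC.vis_zero hx hxR).symm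
        have hτpos : 0 < τ := lt_of_le_of_ne hτ0 fun h => hm0 (by rw [hm, ← h, zero_smul])
        have := vis_lemma hC hyR hxR hmR vxy.symm hym vxm
        rw [hm, norm_smul, real_inner_smul_right, real_inner_self_eq_norm_sq, Real.norm_eq_abs, 
          abs_of_nonneg hτ0, real_inner_comm] at this
        have h2 : (τ * ‖y‖) * (⟪x, y⟫_ℝ + ‖x‖ * ‖y‖) ≤ 0 := by linarith
        have h3 : ⟪x, y⟫_ℝ + ‖x‖ * ‖y‖ ≤ 0 := by
          by_contra h; push Not at h
          linarith [mul_pos (mul_pos hτpos hypos) h]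
        have h4 := mul_nonneg hτ0 (neg_nonneg.2 h3)
        have h5 : ‖x‖ * (2 * τ * ‖y‖) = ‖x‖ * (‖y‖ - ‖z‖) := by rw [hτ]
        nlinarith
    refine hd.trans ?_
    rw [dC_vis vxy, norm_sub_sq_real]
    by_cases vxz : Vis C x z
    · rw [dC_vis vxz, norm_sub_sq_real]
      have := vis_lemma hC hxR hyR hzR vxy vxz hv
      have h1 : ‖y‖ * ((1 - 2 * τ) * ⟪x, y⟫_ℝ + ⟪x, z⟫_ℝ) ≤ 0 := by
        have : ‖y‖ * (1 - 2 * τ) = ‖z‖ := by linarith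
        calc _ = ‖y‖ * (1 - 2 * τ) * ⟪x, y⟫_ℝ + ‖y‖ * ⟪x, z⟫_ℝ := by ring
          _ ≤ 0 := by rw [this]; linarith
      have h2 : (1 - 2 * τ) * ⟪x, y⟫_ℝ + ⟪x, z⟫_ℝ ≤ 0 := by
        by_contra h; push Not at h; linarith [mul_pos hypos h]
      linarith
    · rw [dC_nvis vxz]
      have h1 : ‖y‖ * (1 - 2 * τ) = ‖z‖ := by linarith
      have h0 : 0 ≤ 1 - 2 * τ := by
        by_contra h; push Not at h; nlinarith
      have h2 : (1 - 2 * τ) * ⟪x, y⟫_ℝ ≤ ‖x‖ * ‖z‖ := by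
        rw [← h1]; nlinarith [mul_le_mul_of_nonneg_left hxy h0]
      linarith
  · refine hub.trans ?_
    rw [dC_nvis vxy]
    by_cases vxz : Vis C x z
    · rw [dC_vis vxz, norm_sub_sq_real]
      nlinarith
    · rw [dC_nvis vxz]
      nlinarith [mul_nonneg hr hZ]

lemma cn_vec (hC : Cn C R) {y z : E2} (hy : y ∈ C) (hz : z ∈ C) 
    (hyR : ‖y‖ < R) (hzR : ‖z‖ < R) : ∃ m ∈ C, ‖m‖ ≤ max ‖y‖ ‖z‖ ∧ ∀ x ∈ C, ‖x‖ < R →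
    (dC C x m)^2 ≤ 1/2 * (dC C x y)^2 + 1/2 * (dC C x z)^2 - 1/4 * (dC C y z)^2 := by
  have main : ∀ y z : E2, y ∈ C → z ∈ C → ‖y‖ < R → ‖z‖ < R → ¬ Vis C y z → ‖z‖ ≤ ‖y‖ →
     ∃ m ∈ C, ‖m‖ ≤ max ‖y‖ ‖z‖ ∧ ∀ x ∈ C, ‖x‖ < R →
    (dC C x m)^2 ≤ 1/2 * (dC C x y)^2 + 1/2 * (dC C x z)^2 - 1/4 * (dC C y z)^2 := by
    intro y z hy hz hyR hzR hv hle
    have hy0 : y ≠ 0 := by rintro rfl; exact hv (hC.vis_zero hz hzR)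
    have hypos := norm_pos_iff.2 hy0
    have h1 : 2 * ((‖y‖ - ‖z‖)/(2*‖y‖)) * ‖y‖ = ‖y‖ - ‖z‖ := by field_simp
    have h2 : 0 ≤ (‖y‖ - ‖z‖)/(2*‖y‖) := div_nonneg (by linarith) (by linarith)
    have h3 : (‖y‖ - ‖z‖)/(2*‖y‖) ≤ 1 := by rw [div_le_one (by linarith)]; linarith [norm_nonneg z]
    refine ⟨((‖y‖ - ‖z‖)/(2*‖y‖)) • y, ?_, ?_, fun x hx hxR =>
      cn_B hC hy hz hyR hzR hv hle h1 h2 h3 rfl hx hxR⟩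
    · exact hC.vis_zero hy hyR ⟨1 - (‖y‖ - ‖z‖)/(2*‖y‖), _, by linarith, h2, by ring, by simp⟩
    · refine le_trans ?_ (le_max_left _ _)
      rw [norm_smul, Real.norm_eq_abs, abs_of_nonneg h2]
      nlinarith
  by_cases hv : Vis C y z
  · have hms : (1/2:ℝ) • y + (1/2:ℝ) • z ∈ segment ℝ y z := ⟨1/2, 1/2, by norm_num, by norm_num, by norm_num, rfl⟩
    refine ⟨_, hv hms, ?_, fun x hx hxR => cn_A hC hyR hzR hv rfl hx hxR⟩
    have := (convex_closedBall (0:E2) (max ‖y‖ ‖z‖)).segment_subset (x := y) (y := z) (by simp) (by simp) hms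
    simpa using this
  · rcases le_total ‖z‖ ‖y‖ with h | h
    · exact main y z hy hz hyR hzR hv h
    · obtain ⟨m, h1, h2, h3⟩ := main z y hz hy hzR hyR (fun h' => hv h'.symm) h
      refine ⟨m, h1, by rwa [max_comm], fun x hx hxR => ?_⟩
      have := h3 x hx hxR
      rw [dC_comm z y] at this; linarith

/-- Global (uniformly local) CN inequality. -/
lemma Good.cn (hX : Good X) : ∃ δ > 0, ∃ mid : X → X → X, ∀ x y z : X, d x y < δ → d y z < δ → d x z < δ → 
    d x (mid y z) ^ 2 ≤ 1/2 * d x y ^ 2 + 1/2 * d x z ^2 - 1/4 * d y z ^ 2 := by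
  choose R hR using fun c : X => hX.chart c c.2
  obtain ⟨δ, hδ, h⟩ := hX.leb (fun c => R c / 2) (fun c => by linarith [(hR c).1])
  have H : ∀ y z : X, ∃ m : X, d y z < δ → ∀ x : X, d x y < δ → d x z < δ → 
      d x m ^ 2 ≤ 1/2 * d x y ^ 2 + 1/2 * d x z ^2 - 1/4 * d y z ^ 2 := by
    intro y z
    by_cases hyz : d y z < δ
    swap
    · exact ⟨y, fun h => absurd h hyz⟩
    obtain ⟨c, hc⟩ := h y
    have hy : dist (y:E2) c < R c / 2 := hc y (by simpa using hδ)
    have hz : dist (z:E2) c < R c / 2 := hc z (by rw [dist_comm]; exact (hX.dist_le_d y z).trans_lt hyz)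
    have hRc := (hR c).1
    obtain ⟨m, hm, hmn, hcn⟩ := cn_vec (hR c).cn (y := (y:E2) - c) (z := (z:E2) - c) (by simp [loc]) (by simp [loc])
      (by rw [← dist_eq_norm]; linarith) (by rw [← dist_eq_norm]; linarith)
    rw [← dist_eq_norm, ← dist_eq_norm] at hmn
    let M : X := ⟨c + m, hm⟩
    have hM : dist (M:E2) c < R c / 2 := by
      rw [dist_eq_norm]; show ‖(c:E2) + m - c‖ < _
      rw [add_sub_cancel_left]; exact hmn.trans_lt (max_lt hy hz)
    refine ⟨M, fun _ x hxy hxz => ?_⟩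
    have hx : dist (x:E2) c < R c / 2 := hc x ((hX.dist_le_d x y).trans_lt hxy)
    rw [hX.d_chart (hR c) x M hx hM, hX.d_chart (hR c) x y hx hy, hX.d_chart (hR c) x z hx hz,
      hX.d_chart (hR c) y z hy hz]
    have := hcn (x - c) (by simp [loc]) (by rw [← dist_eq_norm]; linarith)
    have e : (M:E2) - c = m := by show (c:E2) + m - c = m; rw [add_sub_cancel_left]
    rw [e]; exact this
  choose mid hmid using H
  exact ⟨δ, hδ, mid, fun x y z h1 h2 h3 => hmid y z h2 x h1 h3⟩

end THPP
end
section
namespace THPP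
set_option linter.all false
local notation "I" => unitInterval
open Filter Topology
variable {X : Set E2}

def CN (X : Set E2) (δ : ℝ) (mid : X → X → X) : Prop :=
  ∀ x y z : X, d x y < δ → d y z < δ → d x z < δ → 
    d x (mid y z) ^ 2 ≤ 1/2 * d x y ^ 2 + 1/2 * d x z ^2 - 1/4 * d y z ^ 2

section
variable {δ : ℝ} {mid : X → X → X}

lemma CN.left (h : CN X δ mid) (hδ : 0 < δ) {y z : X} (hyz : d y z < δ) : d y (mid y z) ≤ d y z / 2 := by
  have := h y y z (by rw [d_self]; exact hδ) hyz hyz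
  rw [d_self] at this
  apply abs_le_of_sq_le_sq' _ (by have := d_nonneg y z; linarith) |>.2
  nlinarith
lemma CN.right (h : CN X δ mid) (hδ : 0 < δ) {y z : X} (hyz : d y z < δ) : d z (mid y z) ≤ d y z / 2 := by
  have := h z y z (by rw [d_comm]; exact hyz) hyz (by rw [d_self]; exact hδ)
  rw [d_self, d_comm z y] at this
  apply abs_le_of_sq_le_sq' _ (by have := d_nonneg y z; linarith) |>.2
  nlinarith
lemma CN.uniq (h : CN X δ mid) (hX : Good X) {y z n : X} {l : ℝ} (h1 : d y n ≤ l) (h2 : d n z ≤ l)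
    (h3 : 2 * l ≤ d y z) (hl : l < δ) (hyz : d y z < δ) : mid y z = n := by
  symm
  apply hX.eq_of_d
  rw [d_comm] at h1
  have := h n y z (by linarith) hyz (by linarith)
  have a := d_nonneg n y
  have b := d_nonneg n z
  have : d n (mid y z) ^ 2 ≤ 0 := by nlinarith
  have := pow_eq_zero_iff (two_ne_zero) |>.1 (le_antisymm this (sq_nonneg _))
  exact this.le
lemma CN.quad4 (h : CN X δ mid) (hX : Good X) {a b c e : X} (hab : d a b < δ) (hbc : d b c < δ) (hce : d c e < δ)
    (hea : d e a < δ) (hbe : d b e < δ) : 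
    d a c ^ 2 + d b e ^ 2 ≤ d a b ^ 2 + d b c ^ 2 + d c e ^ 2 + d e a ^ 2 := by
  have h1 := h a b e hab hbe (by rw [d_comm]; exact hea)
  have h2 := h c b e (by rw [d_comm]; exact hbc) hbe hce
  have h3 := hX.d_tri a (mid b e) c
  rw [d_comm (mid b e) c] at h3
  rw [d_comm c b] at h2
  rw [d_comm a e] at h1
  have := d_nonneg a c
  nlinarith [sq_nonneg (d a (mid b e) - d c (mid b e))]
lemma CN.quad (h : CN X δ mid) (hX : Good X) {y z y' z' : X} (h1 : d y y' < δ/4) (h2 : d z z' < δ/4)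
    (h3 : d y z < δ/2) (h4 : d y' z' < δ/2) : 
    d (mid y z) (mid y' z') ^ 2 ≤ 1/2 * (d y y' ^ 2 + d z z' ^ 2) := by
  have hδ : 0 < δ := by linarith [d_nonneg y y']
  have a1 := h.left hδ (show d y' z' < δ by linarith)
  have a2 := h.right hδ (show d y' z' < δ by linarith)
  set m' := mid y' z' with hm'
  have t1 := hX.d_tri m' y' y
  have t2 := hX.d_tri m' z' z
  have t3 := hX.d_tri y y' z'
  have t4 := hX.d_tri z z' y'
  rw [d_comm m' y', d_comm y' y] at t1
  rw [d_comm m' z', d_comm z' z] at t2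
  rw [d_comm z' y'] at t4
  have k1 := h m' y z (by linarith) (by linarith) (by linarith)
  have k2 := h y y' z' (by linarith) (by linarith) (by linarith)
  have k3 := h z y' z' (by linarith) (by linarith) (by linarith)
  have k4 := h.quad4 hX (a := y) (b := y') (c := z') (e := z) (by linarith) (by linarith) 
    (by rw [d_comm]; linarith) (by rw [d_comm]; linarith) (by rw [d_comm]; linarith)
  rw [← hm'] at k2 k3
  rw [d_comm m' y, d_comm m' z] at k1
  rw [d_comm z' z, d_comm z y] at k4
  rw [d_comm y' z] at k4
  rw [d_comm (mid y z)]
  linarith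
end

lemma heat (n : ℕ) (e : ℕ → ℕ → ℝ) (B : ℝ) (h0 : ∀ k, e k 0 ≤ B) (hn : ∀ k, e k n ≤ B)
    (hs : ∀ k j, 0 < j → j < n → e (k+1) j ≤ 1/2 * (e k (j-1) + e k (j+1))) {ε : ℝ} (hε : 0 < ε) :
    ∃ k, ∀ j ≤ n, e k j ≤ B + ε := by
  rcases Nat.eq_zero_or_pos n with rfl | hnpos
  · exact ⟨0, fun j hj => by obtain rfl : j = 0 := by omega
                             linarith [h0 0]⟩
  set M : ℝ := ∑ j ∈ Finset.range (n+1), |e 0 j - B| with hM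
  have hM0 : 0 ≤ M := Finset.sum_nonneg fun _ _ => abs_nonneg _
  have hn1 : (1:ℝ) ≤ n := by exact_mod_cast hnpos
  set ρ : ℝ := 1 - 1/(n:ℝ)^2 with hρ
  have hn2 : (1:ℝ) ≤ (n:ℝ)^2 := by nlinarith
  have hρ0 : 0 ≤ ρ := by rw [hρ, sub_nonneg, div_le_one (by linarith)]; exact hn2
  have hρ1 : ρ < 1 := by rw [hρ]; have : 0 < 1/(n:ℝ)^2 := by positivity
                         linarith
  have key : ∀ k, ∀ j ≤ n, e k j ≤ B + M * ρ^k * (j * (n - j)) := by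
    intro k
    induction k with
    | zero =>
      intro j hj
      rcases Nat.eq_zero_or_pos j with rfl | hj0
      · simpa using h0 0
      rcases eq_or_lt_of_le hj with rfl | hjn
      · simpa using hn 0
      have h1 : |e 0 j - B| ≤ M := 
        Finset.single_le_sum (f := fun j => |e 0 j - B|) (fun _ _ => abs_nonneg _) (Finset.mem_range.2 (by omega))
      have h2 : (1:ℝ) ≤ j := by exact_mod_cast hj0
      have h3 : (1:ℝ) ≤ n - j := by
        have : ((j+1 : ℕ):ℝ) ≤ n := by exact_mod_cast hjn
        push_cast at this; linarith
      have h4 : 1 ≤ (j:ℝ) * (n - j) := by nlinarith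
      have h5 := le_abs_self (e 0 j - B)
      simp only [pow_zero, mul_one]
      nlinarith
    | succ k ih =>
      intro j hj
      rcases Nat.eq_zero_or_pos j with rfl | hj0
      · simpa using h0 (k+1)
      rcases eq_or_lt_of_le hj with rfl | hjn
      · simpa using hn (k+1)
      have i1 := ih (j-1) (by omega)
      have i2 := ih (j+1) (by omega)
      rw [Nat.cast_sub (by omega)] at i1
      push_cast at i1 i2
      have i3 := hs k j hj0 hjn
      have h2 : (0:ℝ) ≤ j := by positivity
      have h3 : (j:ℝ) ≤ n := by exact_mod_cast hj
      have h4 : (j:ℝ) * (n - j) - 1 ≤ ρ * (j * (n - j)) := by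
        have : 1/(n:ℝ)^2 * (j * (n - j)) ≤ 1 := by
          rw [one_div, inv_mul_le_iff₀ (by positivity)]
          nlinarith
        rw [hρ]; linarith
      have h5 : 0 ≤ M * ρ^k := by positivity
      have h6 := mul_le_mul_of_nonneg_left h4 h5
      rw [pow_succ]
      nlinarith
  have hlim : Tendsto (fun k : ℕ => M * ρ^k * (n:ℝ)^2) atTop (𝓝 0) := by
    have := ((tendsto_pow_atTop_nhds_zero_of_lt_one hρ0 hρ1).const_mul M).mul_const ((n:ℝ)^2)
    simpa using this
  obtain ⟨k, hk⟩ := (hlim.eventually_lt_const hε).exists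
  refine ⟨k, fun j hj => (key k j hj).trans ?_⟩
  have h2 : (0:ℝ) ≤ j := by positivity
  have h3 : (j:ℝ) ≤ n := by exact_mod_cast hj
  have h4 : (j:ℝ) * (n - j) ≤ (n:ℝ)^2 := by nlinarith
  have h5 : 0 ≤ M * ρ^k := by positivity
  nlinarith [mul_le_mul_of_nonneg_left h4 h5]

def En (n : ℕ) (c : ℕ → X) : ℝ := ∑ i ∈ Finset.range n, d (c i) (c (i+1)) ^ 2

structure Grid (δ : ℝ) (n : ℕ) (o : X) (qs ca cb : ℕ → X) (Y : ℕ → ℕ → X) : Prop where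
  hor : ∀ j i, j < n → i ≤ n → d (Y j i) (Y (j+1) i) < δ
  ver : ∀ j i, j ≤ n → i < n → d (Y j i) (Y j (i+1)) < δ
  top : ∀ j, j ≤ n → Y j 0 = o
  bot : ∀ j, j ≤ n → Y j n = qs j
  lef : Y 0 = ca
  rig : Y n = cb

def stp (mid : X → X → X) (n : ℕ) (Y : ℕ → ℕ → X) : ℕ → ℕ → X := fun j i =>
  if 0 < j ∧ j < n then mid (Y (j-1) i) (Y (j+1) i) else Y j i

lemma Grid.stp {δ : ℝ} {mid : X → X → X} (h : CN X δ mid) (hX : Good X) (hδ : 0 < δ) {n : ℕ} (hn : 2 ≤ n) {o : X} {qs ca cb : ℕ → X}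
    (hq : ∀ j, 0 < j → j < n → mid (qs (j-1)) (qs (j+1)) = qs j) {Y : ℕ → ℕ → X} (hY : Grid (δ/4) n o qs ca cb Y) :
    Grid (δ/4) n o qs ca cb (stp mid n Y) ∧ 
    ∀ j, 0 < j → j < n → En n (THPP.stp mid n Y j) ≤ 1/2 * (En n (Y (j-1)) + En n (Y (j+1))) := by
  have h2 : ∀ j i, 0 < j → j < n → i ≤ n → d (Y (j-1) i) (Y (j+1) i) < δ/2 := by
    intro j i h0 h1 hi
    have a1 := hY.hor (j-1) i (by omega) hi
    have a2 := hY.hor j i h1 hi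
    rw [show j - 1 + 1 = j by omega] at a1
    linarith [hX.d_tri (Y (j-1) i) (Y j i) (Y (j+1) i)]
  have sq : ∀ {x y w : ℝ}, 0 ≤ x → x < δ/4 → 0 ≤ y → y < δ/4 → 0 ≤ w → w^2 ≤ 1/2 * (x^2+y^2) → w < δ/4 := by
    intro x y w hx hx' hy hy' hw hh
    by_contra hc; push Not at hc
    nlinarith
  have hv : ∀ j i, 0 < j → j < n → i < n → d (THPP.stp mid n Y j i) (THPP.stp mid n Y j (i+1)) ^ 2 ≤
      1/2 * (d (Y (j-1) i) (Y (j-1) (i+1)) ^ 2 + d (Y (j+1) i) (Y (j+1) (i+1)) ^ 2) := by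
    intro j i h0 h1 hi
    simp only [THPP.stp, h0, h1, and_self, if_true]
    exact h.quad hX (hY.ver _ _ (by omega) hi) (hY.ver _ _ (by omega) hi) (h2 j i h0 h1 hi.le) (h2 j (i+1) h0 h1 hi)
  refine ⟨⟨?_, ?_, ?_, ?_, ?_, ?_⟩, ?_⟩
  · intro j i hj hi
    by_cases h0 : 0 < j
    · by_cases h1 : j + 1 < n
      · have : d (THPP.stp mid n Y j i) (THPP.stp mid n Y (j+1) i) ^ 2 ≤ 
            1/2 * (d (Y (j-1) i) (Y j i) ^ 2 + d (Y (j+1) i) (Y (j+2) i) ^ 2) := by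
          have hj' : 0 < j + 1 := by omega
          simp only [THPP.stp, h0, hj, h1, hj', and_self, if_true]
          have := hY.hor (j-1) i (by omega) hi
          rw [show j - 1 + 1 = j by omega] at this
          exact h.quad hX this (hY.hor _ _ (by omega) hi) (h2 j i h0 hj hi) (h2 (j+1) i (by omega) h1 hi)
        have t := hY.hor (j-1) i (by omega) hi
        rw [show j - 1 + 1 = j by omega] at t
        exact sq (d_nonneg _ _) t (d_nonneg _ _) (hY.hor _ _ (by omega) hi) (d_nonneg _ _) this
      · have hj' : ¬ (j + 1 < n) := by omega
        simp only [THPP.stp, h0, hj, hj', and_self, if_true, and_false, if_false]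
        have := h2 j i h0 hj hi
        rw [d_comm]
        linarith [h.right hδ (show d (Y (j-1) i) (Y (j+1) i) < δ by linarith)]
    · obtain rfl : j = 0 := by omega
      have h1 : 0 + 1 < n := by omega
      have e0 : THPP.stp mid n Y 0 i = Y 0 i := by simp [THPP.stp]
      have e1 : THPP.stp mid n Y (0+1) i = mid (Y 0 i) (Y 2 i) :=
        if_pos ⟨by omega, h1⟩
      rw [e0, e1]
      have := h2 1 i (by omega) (by omega) hi
      have t := h.left hδ (show d (Y (1-1) i) (Y (1+1) i) < δ by linarith)
      simp only [Nat.sub_self, Nat.reduceAdd] at t this ⊢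
      linarith
  · intro j i hj hi
    by_cases h0 : 0 < j ∧ j < n
    · exact sq (d_nonneg _ _) (hY.ver (j-1) i (by omega) hi) (d_nonneg _ _) (hY.ver (j+1) i (by omega) hi)
        (d_nonneg _ _) (hv j i h0.1 h0.2 hi)
    · simp only [THPP.stp, h0, if_false]
      exact hY.ver j i hj hi
  · intro j hj
    by_cases h0 : 0 < j ∧ j < n
    · simp only [THPP.stp, h0, and_self, if_true]
      rw [hY.top _ (by omega), hY.top _ (by omega)]
      symm; apply hX.eq_of_d
      have := h.left hδ (show d o o < δ by rw [d_self]; exact hδ)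
      rw [d_self] at this; linarith
    · simp only [THPP.stp, h0, if_false]; exact hY.top j hj
  · intro j hj
    by_cases h0 : 0 < j ∧ j < n
    · simp only [THPP.stp, h0, and_self, if_true]
      rw [hY.bot _ (by omega), hY.bot _ (by omega)]
      exact hq j h0.1 h0.2
    · simp only [THPP.stp, h0, if_false]; exact hY.bot j hj
  · funext i; simp [THPP.stp]; rw [hY.lef]
  · funext i; simp [THPP.stp]; rw [hY.rig]
  · intro j h0 h1
    unfold En
    rw [← Finset.sum_add_distrib, Finset.mul_sum]
    exact Finset.sum_le_sum fun i hi => hv j i h0 h1 (Finset.mem_range.1 hi)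

lemma grid_iter {δ : ℝ} {mid : X → X → X} (h : CN X δ mid) (hX : Good X) (hδ : 0 < δ) {n : ℕ} (hn : 2 ≤ n) {o : X} {qs ca cb : ℕ → X}
    (hq : ∀ j, 0 < j → j < n → mid (qs (j-1)) (qs (j+1)) = qs j) {Y : ℕ → ℕ → X} (hY : Grid (δ/4) n o qs ca cb Y)
    {B : ℝ} (ha : En n ca ≤ B) (hb : En n cb ≤ B) {ε : ℝ} (hε : 0 < ε) :
    ∃ Z : ℕ → ℕ → X, Grid (δ/4) n o qs ca cb Z ∧ ∀ j ≤ n, En n (Z j) ≤ B + ε := by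
  have hit : ∀ k, Grid (δ/4) n o qs ca cb ((stp mid n)^[k] Y) := by
    intro k
    induction k with
    | zero => exact hY
    | succ k ih => rw [Function.iterate_succ_apply']; exact (Grid.stp h hX hδ hn hq ih).1
  obtain ⟨k, hk⟩ := heat n (fun k j => En n ((stp mid n)^[k] Y j)) B (fun k => by rw [(hit k).lef]; exact ha)
    (fun k => by rw [(hit k).rig]; exact hb) (fun k j h0 h1 => by
      simp only [Function.iterate_succ_apply']
      exact (Grid.stp h hX hδ hn hq (hit k)).2 j h0 h1) hε
  exact ⟨_, hit k, hk⟩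

end THPP
end
section
namespace THPP
set_option linter.all false
local notation "I" => unitInterval
open Filter Topology
variable {X : Set E2}

def LSC (X : Set E2) (δ : ℝ) : Prop := ∀ (c y z : X) (p q : Path y z), (∀ t, dist (p t : E2) c < δ) →
    (∀ t, dist (q t : E2) c < δ) → p.Homotopic q

lemma LSC.short {δ : ℝ} (h : LSC X δ) {y z y' z' : X} (hy : y = y') (hz : z = z') (p : Path y z) (q : Path y' z')
    (hp : cost p < ENNReal.ofReal δ) (hq : cost q < ENNReal.ofReal δ) : HR p q := by
  subst hy; subst hz
  have key : ∀ r : Path y z, cost r < ENNReal.ofReal δ → ∀ t, dist (r t : E2) y < δ := by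
    intro r hr t
    have h1 := edist_le_cost r t 0
    rw [Path.source, edist_dist] at h1
    exact (ENNReal.ofReal_lt_ofReal_iff_of_nonneg dist_nonneg).1 (h1.trans_lt hr)
  exact HR.of_hom (h y y z p q (key p hp) (key q hq))

lemma cost_chain (c : ℕ → X) (e : ∀ i : ℕ, Path (c i) (c (i+1))) (n : ℕ) :
    cost (chain c e n) = ∑ i ∈ Finset.range n, cost (e i) := by
  induction n with
  | zero => simp [chain, cost_refl]
  | succ n ih => rw [Finset.sum_range_succ, ← ih, chain, cost_trans]

lemma ladder {δ η : ℝ} (h : LSC X δ) (hη : 2 * η ≤ δ) (e : ∀ y z : X, Path y z) (Y Z : ℕ → X) (n : ℕ)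
    (hY : ∀ i < n, cost (e (Y i) (Y (i+1))) < ENNReal.ofReal η) 
    (hZ : ∀ i < n, cost (e (Z i) (Z (i+1))) < ENNReal.ofReal η)
    (hYZ : ∀ i ≤ n, cost (e (Y i) (Z i)) < ENNReal.ofReal η) :
    ∀ k ≤ n, HR ((chain Y (fun i => e (Y i) (Y (i+1))) k).trans (e (Y k) (Z k)))
      ((e (Y 0) (Z 0)).trans (chain Z (fun i => e (Z i) (Z (i+1))) k)) := by
  have hη0 : 0 < η := by
    have := (bot_le (a := cost (e (Y 0) (Z 0)))).trans_lt (hYZ 0 (Nat.zero_le _))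
    exact ENNReal.ofReal_pos.1 this
  have add : ∀ {x y : ENNReal}, x < ENNReal.ofReal η → y < ENNReal.ofReal η → x + y < ENNReal.ofReal δ := by
    intro x y hx hy
    refine (ENNReal.add_lt_add hx hy).trans_le ?_
    rw [← ENNReal.ofReal_add hη0.le hη0.le]
    exact ENNReal.ofReal_le_ofReal (by linarith)
  intro k
  induction k with
  | zero => intro _; exact (HR.refl_trans _).trans (HR.trans_refl _).symm
  | succ k ih =>
    intro hk
    have ih' := ih (by omega)
    have sq : HR ((e (Y k) (Y (k+1))).trans (e (Y (k+1)) (Z (k+1)))) ((e (Y k) (Z k)).trans (e (Z k) (Z (k+1)))) := by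
      apply h.short rfl rfl
      · rw [cost_trans]; exact add (hY k (by omega)) (hYZ _ hk)
      · rw [cost_trans]; exact add (hYZ k (by omega)) (hZ k (by omega))
    refine (HR.assoc _ _ _).trans ?_
    refine (HR.comp HR.rfl' sq).trans ?_
    refine (HR.assoc _ _ _).symm.trans ?_
    refine (HR.comp ih' HR.rfl').trans ?_
    exact HR.assoc _ _ _

def tk (n i : ℕ) : I := Set.projIcc 0 1 zero_le_one ((i:ℝ)/n)

lemma tk_val {n i : ℕ} (h : i ≤ n) : (tk n i).1 = (i:ℝ)/n := by
  unfold tk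
  rw [Set.projIcc_of_mem]
  constructor
  · positivity
  · apply div_le_one_of_le₀ _ (by positivity); exact_mod_cast h
lemma tk_zero (n : ℕ) : tk n 0 = 0 := Subtype.ext (by rw [tk_val (Nat.zero_le _)]; simp)
lemma tk_self {n : ℕ} (hn : 0 < n) : tk n n = 1 := Subtype.ext (by rw [tk_val le_rfl]; exact div_self (Nat.cast_ne_zero.2 hn.ne'))
lemma tk_sub {n i : ℕ} (h : i < n) : |(tk n i).1 - (tk n (i+1)).1| = 1/n := by
  rw [tk_val h.le, tk_val h, ← sub_div]
  push_cast
  rw [show (i:ℝ) - (i+1) = -1 by ring, neg_div, abs_neg, abs_of_nonneg (by positivity)]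

def Lip {u v : X} (p : Path u v) (K : ℝ) : Prop := 0 ≤ K ∧ ∀ s t : I, dist (p s : E2) (p t) ≤ K * |s.1 - t.1|

lemma Lip.cost_sub {u v : X} {p : Path u v} {K : ℝ} (h : Lip p K) {n i : ℕ} (hi : i < n) :
    cost (subpath p (tk n i) (tk n (i+1))) ≤ ENNReal.ofReal (K / n) := by
  have := cost_subpath_le p h.1 h.2 (tk n i) (tk n (i+1))
  rwa [tk_sub hi, mul_one_div] at this

lemma Lip.d_le {u v : X} {p : Path u v} {K : ℝ} (h : Lip p K) {n i : ℕ} (hi : i < n) :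
    d (p (tk n i)) (p (tk n (i+1))) ≤ K / n :=
  Good.d_le_of _ (div_nonneg h.1 (by positivity)) (h.cost_sub hi)

lemma sampled {δ : ℝ} (h : LSC X δ) (e : ∀ y z : X, Path y z) {u v : X} (p : Path u v) {K : ℝ} (hK : Lip p K)
    {n : ℕ} (hn : K / n < δ) (he : ∀ i < n, cost (e (p (tk n i)) (p (tk n (i+1)))) < ENNReal.ofReal δ) :
    ∀ i ≤ n, HR (chain (fun i => p (tk n i)) (fun i => e (p (tk n i)) (p (tk n (i+1)))) i) (subpath0 p (tk n i)) := by
  intro i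
  induction i with
  | zero => 
    intro _
    have : subpath0 p (tk n 0) = subpath0 p (tk n 0) := rfl
    apply HR.of_eq
    intro t
    show p (tk n 0) = p ⟨(1 - t.1) * (0:I).1 + t.1 * (tk n 0).1, _⟩
    congr 1
    apply Subtype.ext
    simp [tk_zero]
  | succ i ih =>
    intro hi
    refine (HR.comp (ih (by omega)) ?_).trans (HR.subpath0_trans p (tk n i) (tk n (i+1)))
    apply h.short rfl rfl _ _ (he i (by omega))
    refine (hK.cost_sub (by omega)).trans_lt ?_
    exact (ENNReal.ofReal_lt_ofReal_iff_of_nonneg (div_nonneg hK.1 (by positivity))).2 hn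

lemma column {δ η : ℝ} (h : LSC X δ) (hη : 2 * η ≤ δ) (hη0 : 0 < η) (e : ∀ y z : X, Path y z) {o u v : X} (a : Path o u) (q : Path u v)
    {Ka L : ℝ} (ha : Lip a Ka) (hq : Lip q L) {n : ℕ} (hn0 : 0 < n) (hn : Ka / n < δ) (hn' : L / n < δ)
    (Z : ℕ → ℕ → X) (ver : ∀ j i, j ≤ n → i < n → cost (e (Z j i) (Z j (i+1))) < ENNReal.ofReal η)
    (hor : ∀ j i, j < n → i ≤ n → cost (e (Z j i) (Z (j+1) i)) < ENNReal.ofReal η)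
    (top : ∀ j ≤ n, Z j 0 = o) (bot : ∀ j ≤ n, Z j n = q (tk n j)) (lef : Z 0 = fun i => a (tk n i)) :
    ∀ j ≤ n, HR (chain (Z j) (fun i => e (Z j i) (Z j (i+1))) n) (a.trans (subpath0 q (tk n j))) := by
  have hηδ : ENNReal.ofReal η ≤ ENNReal.ofReal δ := ENNReal.ofReal_le_ofReal (by linarith)
  have hδ0 : 0 < δ := by linarith
  intro j
  induction j with
  | zero =>
    intro _
    have ver0 := fun i => ver 0 i (Nat.zero_le _)
    rw [lef] at ver0 ⊢
    have := sampled h e a ha hn (fun i hi => (ver0 i hi).trans_le hηδ) n le_rfl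
    refine this.trans ?_
    rw [tk_self hn0]
    refine (HR.subpath0_one a).trans ?_
    refine (HR.trans_refl a).symm.trans (HR.comp HR.rfl' ?_)
    rw [tk_zero]
    exact (HR.subpath0_zero q).symm
  | succ j ih =>
    intro hj
    have l := ladder h hη e (Z j) (Z (j+1)) n (fun i hi => ver j i (by omega) hi) (fun i hi => ver (j+1) i hj hi)
      (fun i hi => hor j i (by omega) hi) n le_rfl
    have t1 : HR (e (Z j 0) (Z (j+1) 0)) (Path.refl (Z (j+1) 0)) := by
      apply h.short (by rw [top j (by omega), top (j+1) hj]) rfl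
      · exact (hor j 0 (by omega) (by omega)).trans_le hηδ
      · rw [cost_refl]; exact ENNReal.ofReal_pos.2 hδ0
    have t2 : HR (e (Z j n) (Z (j+1) n)) (subpath q (tk n j) (tk n (j+1))) := by
      apply h.short (bot j (by omega)) (bot (j+1) hj)
      · exact (hor j n (by omega) le_rfl).trans_le hηδ
      · refine (hq.cost_sub (by omega)).trans_lt ?_
        exact (ENNReal.ofReal_lt_ofReal_iff_of_nonneg (div_nonneg hq.1 (by positivity))).2 hn'
    refine (HR.refl_trans _).symm.trans ?_
    refine (HR.comp t1.symm HR.rfl').trans (l.symm.trans ?_)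
    refine (HR.comp (ih (by omega)) t2).trans ?_
    refine (HR.assoc _ _ _).trans (HR.comp HR.rfl' ?_)
    exact HR.subpath0_trans q _ _

/-- the homotopy square -/
lemma exists_square {Y : Type*} [TopologicalSpace Y] {o u v : Y} {a : Path o u} {q : Path u v} {b : Path o v} (h : (a.trans q).Homotopic b) :
    ∃ K : I × I → Y, Continuous K ∧ (∀ s, K (s, 0) = a s) ∧ (∀ s, K (s, 1) = b s) ∧ (∀ t, K (0, t) = o) ∧
      ∀ t, K (1, t) = q t := by
  obtain ⟨G⟩ := h
  let τ : I × I → I := fun p => Set.projIcc 0 1 zero_le_one (p.2.1 * (1 - p.1.1) / (1 - p.1.1 * p.2.1))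
  let σ : I × I → I := fun p => Set.projIcc 0 1 zero_le_one (p.1.1 * (1 + p.2.1) / 2)
  have hσ : Continuous σ := continuous_projIcc.comp (by fun_prop)
  have hG1 : ∀ x, G (x, 1) = v := fun x => by simp
  have hG0 : ∀ x, G (x, 0) = o := fun x => by simp
  refine ⟨fun p => G (τ p, σ p), ?_, ?_, ?_, ?_, ?_⟩
  · rw [continuous_iff_continuousAt]
    rintro ⟨s, t⟩
    by_cases h : s.1 * t.1 = 1
    · have hs : s = 1 := Subtype.ext (by
        show s.1 = 1
        have := s.2.1; have := s.2.2; have := t.2.1; have := t.2.2; nlinarith)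
      have ht : t = 1 := Subtype.ext (by
        show t.1 = 1
        have := s.2.1; have := s.2.2; have := t.2.1; have := t.2.2; nlinarith)
      subst hs; subst ht
      have hs1 : σ (1, 1) = 1 := by
        show Set.projIcc (0:ℝ) 1 _ _ = _
        norm_num
      show Tendsto _ _ (𝓝 (G (τ (1,1), σ (1,1))))
      rw [hs1, hG1]
      intro U hU
      have ev : ∀ᶠ y in 𝓝 (1:I), ∀ x ∈ (Set.univ : Set I), G (x, y) ∈ U := by
        apply isCompact_univ.eventually_forall_of_forall_eventually
        intro x _
        have : ContinuousAt (fun z : I × I => G (z.2, z.1)) (1, x) := by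
          apply Continuous.continuousAt; exact G.continuous.comp continuous_swap
        have h2 : Tendsto (fun z : I × I => G (z.2, z.1)) (𝓝 (1, x)) (𝓝 v) := by
          have := this.tendsto; simp only [] at this; rwa [hG1] at this
        first
          | exact h2 hU
          | (have := h2 hU; exact (continuous_swap.tendsto _).eventually this)
      have hσt : Tendsto σ (𝓝 (1,1)) (𝓝 1) := by
        have := hσ.tendsto (1,1); rwa [hs1] at this
      have := hσt.eventually ev
      show ∀ᶠ p in 𝓝 ((1,1) : I × I), G (τ p, σ p) ∈ U
      filter_upwards [this] with p hp
      exact hp _ trivial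
    · have hτ : ContinuousAt τ (s, t) := by
        apply continuous_projIcc.continuousAt.comp
        apply ContinuousAt.div
        · fun_prop
        · fun_prop
        · show 1 - s.1 * t.1 ≠ 0
          intro h'; exact h (by linarith)
      exact G.continuous.continuousAt.comp (hτ.prodMk hσ.continuousAt)
  · intro s
    have h1 : τ (s, 0) = 0 := by
      show Set.projIcc (0:ℝ) 1 _ _ = _
      simp only [Set.Icc.coe_zero, zero_mul, zero_div]
      exact Set.projIcc_left _
    have h2 : (σ (s, 0)).1 = s.1 / 2 := by
      show (Set.projIcc (0:ℝ) 1 _ _).1 = _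
      have := s.2.1; have := s.2.2
      rw [Set.projIcc_of_mem]
      · simp
      · constructor <;> simp <;> linarith
    show G (τ (s,0), σ (s,0)) = _
    rw [h1, G.apply_zero]
    show (a.trans q) _ = _
    rw [Path.trans_apply]
    have hle : (σ (s, 0)).1 ≤ 1/2 := by rw [h2]; linarith [s.2.2]
    rw [dif_pos hle]
    congr 1
    apply Subtype.ext
    show 2 * (σ (s, 0)).1 = s.1
    rw [h2]; ring
  · intro s
    have h2 : σ (s, 1) = s := by
      show (Set.projIcc (0:ℝ) 1 _ _) = _
      have : s.1 * (1 + (1:I).1) / 2 = s.1 := by simp; ring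
      simp only [this]
      exact Set.projIcc_of_mem _ s.2
    show G (τ (s,1), σ (s,1)) = _
    rw [h2]
    by_cases hs : s = 1
    · subst hs; rw [hG1]; simp
    · have h1 : τ (s, 1) = 1 := by
        show Set.projIcc (0:ℝ) 1 _ _ = _
        have hne : (1:ℝ) - s.1 ≠ 0 := by
          intro h; exact hs (Subtype.ext (by show s.1 = 1; linarith))
        have : (1:I).1 * (1 - s.1) / (1 - s.1 * (1:I).1) = 1 := by
          simp only [Set.Icc.coe_one, one_mul, mul_one]; exact div_self hne
        simp only [this]
        exact Set.projIcc_right _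
      rw [h1, G.apply_one]; rfl
  · intro t
    have h2 : σ (0, t) = 0 := by
      show (Set.projIcc (0:ℝ) 1 _ _) = _
      simp only [Set.Icc.coe_zero, zero_mul, zero_div]
      exact Set.projIcc_left _
    show G (τ (0,t), σ (0,t)) = _
    rw [h2, hG0]
  · intro t
    have h1 : τ (1, t) = 0 := by
      show Set.projIcc (0:ℝ) 1 _ _ = _
      simp only [Set.Icc.coe_one, sub_self, mul_zero, zero_div]
      exact Set.projIcc_left _
    have h2 : (σ (1, t)).1 = (1 + t.1) / 2 := by
      show (Set.projIcc (0:ℝ) 1 _ _).1 = _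
      have := t.2.1; have := t.2.2
      rw [Set.projIcc_of_mem]
      · simp
      · constructor <;> simp <;> linarith
    show G (τ (1,t), σ (1,t)) = _
    rw [h1, G.apply_zero]
    show (a.trans q) _ = _
    rw [Path.trans_apply]
    split_ifs with hle
    · rw [h2] at hle
      have : t = 0 := Subtype.ext (by show t.1 = 0; linarith [t.2.1])
      subst this
      rw [q.source]
      have e : (⟨2 * (σ (1, 0)).1, (unitInterval.mul_pos_mem_iff zero_lt_two).2 ⟨(σ (1,0)).2.1, hle.trans' (by rw [h2])⟩⟩ : I) = 1 :=
        Subtype.ext (by show 2 * (σ (1, 0)).1 = 1; rw [h2]; simp)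
      rw [e, a.target]
    · congr 1
      apply Subtype.ext
      show 2 * (σ (1, t)).1 - 1 = t.1
      rw [h2]; ring

end THPP
end
section
namespace THPP
set_option linter.all false
local notation "I" => unitInterval
open Filter Topology
variable {X : Set E2}

lemma CN.mono {δ δ' : ℝ} {mid : X → X → X} (h : CN X δ mid) (hd : δ' ≤ δ) : CN X δ' mid :=
  fun x y z h1 h2 h3 => h x y z (h1.trans_le hd) (h2.trans_le hd) (h3.trans_le hd)

lemma Lip.sub_sub {u v : X} {q : Path u v} {L : ℝ} (hq : Lip q L) {s t : I} (hst : s ≤ t) :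
    cost (subpath q s t) ≤ ENNReal.ofReal (L * (t.1 - s.1)) := by
  have := cost_subpath_le q hq.1 hq.2 s t
  rwa [abs_sub_comm, abs_of_nonneg (sub_nonneg.2 (show s.1 ≤ t.1 from hst))] at this

lemma geod_local (hX : Good X) {δ : ℝ} (h : LSC X δ) {u v : X} {q : Path u v} {L : ℝ} (hq : Lip q L)
    (hopt : ∀ r : Path u v, q.Homotopic r → ENNReal.ofReal L ≤ cost r) {s t : I} (hst : s ≤ t)
    (hs : L * (t.1 - s.1) < δ) : L * (t.1 - s.1) ≤ d (q s) (q t) := by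
  have hst' : s.1 ≤ t.1 := hst
  have hL := hq.1
  have n1 : 0 ≤ L * (t.1 - s.1) := mul_nonneg hL (by linarith)
  apply hX.le_d_of
  intro r
  by_contra hlt
  rw [not_le] at hlt
  have c1 : cost r < ENNReal.ofReal δ := hlt.trans_le (ENNReal.ofReal_le_ofReal hs.le)
  have c2 : cost (subpath q s t) < ENNReal.ofReal δ := (hq.sub_sub hst).trans_lt
    ((ENNReal.ofReal_lt_ofReal_iff_of_nonneg n1).2 hs)
  have hr : HR r (subpath q s t) := h.short rfl rfl _ _ c1 c2
  let w : Path u v := (((subpath q 0 s).trans (r.trans (subpath q t 1))).cast q.source.symm q.target.symm)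
  have hw : HR q w := by
    refine HR.trans ?_ (HR.cast _ _).symm
    refine HR.trans ?_ (HR.comp HR.rfl' (HR.comp hr HR.rfl')).symm
    refine HR.trans ?_ (HR.comp HR.rfl' (HR.subpath_trans q s t 1)).symm
    exact ((HR.subpath_trans q 0 s 1).trans (HR.subpath_zero_one q)).symm
  have h1 := hopt w hw.hom
  have h0s : (0:I) ≤ s := s.2.1
  have ht1 : t ≤ 1 := t.2.2
  have h2 : cost w < ENNReal.ofReal L := by
    show cost (Path.cast _ _ _) < _
    rw [cost_cast, cost_trans, cost_trans]
    have e1 := hq.sub_sub h0s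
    have e2 := hq.sub_sub ht1
    have hs0 := s.2.1
    have ht1' := t.2.2
    simp only [Set.Icc.coe_zero, Set.Icc.coe_one, sub_zero] at e1 e2
    calc _ < ENNReal.ofReal (L * s.1) + (ENNReal.ofReal (L * (t.1 - s.1)) + ENNReal.ofReal (L * (1 - t.1))) := by
          apply ENNReal.add_lt_add_of_le_of_lt (ne_top_of_le_ne_top ENNReal.ofReal_ne_top e1) e1
          exact ENNReal.add_lt_add_of_lt_of_le (ne_top_of_le_ne_top ENNReal.ofReal_ne_top e2) hlt e2
      _ = _ := by
          rw [← ENNReal.ofReal_add n1 (mul_nonneg hL (by linarith)), ← ENNReal.ofReal_add (mul_nonneg hL hs0)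
            (by have := mul_nonneg hL (sub_nonneg.2 ht1'); linarith)]
          congr 1; ring
  exact absurd h1 (not_le.2 h2)

lemma En_le {o u : X} {a : Path o u} {Ka A : ℝ} (ha : Lip a Ka) (hA : Ka ≤ A) {n : ℕ} (hn : 0 < n) :
    En n (fun i => a (tk n i)) ≤ A^2 / n := by
  unfold En
  have : ∀ i ∈ Finset.range n, d (a (tk n i)) (a (tk n (i+1))) ^ 2 ≤ (A / n)^2 := by
    intro i hi
    have h1 := ha.d_le (Finset.mem_range.1 hi)
    have h2 : Ka / n ≤ A / n := by gcongr
    have := d_nonneg (a (tk n i)) (a (tk n (i+1)))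
    gcongr; linarith
  refine (Finset.sum_le_sum this).trans (le_of_eq ?_)
  have hn' : (n:ℝ) ≠ 0 := Nat.cast_ne_zero.2 hn.ne'
  simp
  field_simp

lemma sum_le_of_En {n : ℕ} (hn : 0 < n) (c : ℕ → X) {A ε : ℝ} (hA : 0 ≤ A) (hε : 0 < ε) 
    (h : En n c ≤ A^2/n + ε^2/n) : ∑ i ∈ Finset.range n, d (c i) (c (i+1)) ≤ A + ε := by
  have h1 := sq_sum_le_card_mul_sum_sq (s := Finset.range n) (f := fun i => d (c i) (c (i+1)))
  have hn' : (0:ℝ) < n := Nat.cast_pos.2 hn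
  have h2 : (n:ℝ) * En n c ≤ A^2 + ε^2 := by
    calc _ ≤ (n:ℝ) * (A^2/n + ε^2/n) := by gcongr
      _ = _ := by field_simp
  rw [Finset.card_range] at h1
  unfold En at h2
  apply abs_le_of_sq_le_sq' _ (by positivity) |>.2
  nlinarith

lemma conv_aux (hX : Good X) {o u v : X} {a : Path o u} {b : Path o v} {q : Path u v} {Ka Kb A L : ℝ}
    (ha : Lip a Ka) (hb : Lip b Kb) (hKa : Ka ≤ A) (hKb : Kb ≤ A) (hq : Lip q L)
    (hopt : ∀ r : Path u v, q.Homotopic r → ENNReal.ofReal L ≤ cost r) (hab : (a.trans q).Homotopic b)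
    {ε : ℝ} (hε : 0 < ε) :
    ∀ᶠ n : ℕ in atTop, ∀ j ≤ n, mCost (a.trans (subpath0 q (tk n j))) ≤ ENNReal.ofReal (A + ε) := by
  have hA : 0 ≤ A := ha.1.trans hKa
  obtain ⟨δ1, hδ1, mid, hcn⟩ := hX.cn
  obtain ⟨δ0, hδ0, hlsc⟩ := hX.lsc
  have hlsc : LSC X δ0 := hlsc
  let δ := min δ1 δ0
  have hδ : 0 < δ := lt_min hδ1 hδ0
  have hcn : CN X δ mid := CN.mono hcn (min_le_left _ _)
  have hδδ0 : δ ≤ δ0 := min_le_right _ _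
  obtain ⟨K, hKc, hK0, hK1, hKt, hKb'⟩ := exists_square hab
  obtain ⟨η, hη, hm2⟩ := hX.m2 (show 0 < δ/4 by linarith)
  have huc := CompactSpace.uniformContinuous_of_continuous hKc
  rw [Metric.uniformContinuous_iff] at huc
  obtain ⟨κ, hκ, huc⟩ := huc η hη
  have ev : ∀ {c x : ℝ}, 0 < x → ∀ᶠ n : ℕ in atTop, c / n < x := fun {c x} hx =>
    (tendsto_const_div_atTop_nhds_zero_nat c).eventually (gt_mem_nhds hx)
  filter_upwards [eventually_ge_atTop 2, ev (c := 1) hκ, ev (c := Ka) hδ0, ev (c := 2 * L) hδ] with n hn2 hnκ hnK hnL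
  have hn0 : 0 < n := by omega
  have hnr : (0:ℝ) < n := Nat.cast_pos.2 hn0
  have hL := hq.1
  have hLn : L / n < δ := by
    have : L / n ≤ 2 * L / n := by gcongr; linarith
    linarith
  have hY : Grid (δ/4) n o (fun j => q (tk n j)) (fun i => a (tk n i)) (fun i => b (tk n i)) (fun j i => K (tk n i, tk n j)) := by
    constructor
    · intro j i hj hi
      apply hm2
      apply huc
      rw [Prod.dist_eq, dist_self]
      apply max_lt hκ
      show |(tk n j).1 - (tk n (j+1)).1| < κ
      rwa [tk_sub hj]
    · intro j i hj hi
      apply hm2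
      apply huc
      rw [Prod.dist_eq, dist_self]
      apply max_lt _ hκ
      show |(tk n i).1 - (tk n (i+1)).1| < κ
      rwa [tk_sub hi]
    all_goals first
      | (intro j; simp [tk_zero, hKt]; done)
      | (intro j; simp [tk_self hn0, hKb']; done)
      | (intro j _; simp [tk_zero, hKt]; done)
      | (intro j _; simp [tk_self hn0, hKb']; done)
      | (funext i; simp [tk_zero, hK0]; done)
      | (funext i; simp [tk_self hn0, hK1]; done)
  have hmid : ∀ j, 0 < j → j < n → mid (q (tk n (j-1))) (q (tk n (j+1))) = q (tk n j) := by
    intro j hj0 hj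
    obtain ⟨j, rfl⟩ : ∃ k, j = k + 1 := ⟨j-1, by omega⟩
    have hle : tk n j ≤ tk n (j+2) := by
      show (tk n j).1 ≤ (tk n (j+2)).1
      rw [tk_val (by omega), tk_val (by omega)]; gcongr; omega
    have hval : L * ((tk n (j+2)).1 - (tk n j).1) = 2 * (L / n) := by
      rw [tk_val (by omega), tk_val (by omega)]; push_cast; field_simp; ring
    have h3 := geod_local hX hlsc hq hopt hle (by rw [hval]; linarith [mul_div_assoc 2 L (n:ℝ)])
    rw [hval] at h3
    have h1 := hq.d_le (n := n) (i := j) (by omega)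
    have h2 := hq.d_le (n := n) (i := j+1) (by omega)
    have h4 := hX.d_tri (q (tk n j)) (q (tk n (j+1))) (q (tk n (j+2)))
    exact hcn.uniq hX h1 h2 h3 hLn (by have := mul_div_assoc 2 L (n:ℝ); show d (q (tk n j)) (q (tk n (j+2))) < δ; linarith)
  obtain ⟨Z, hZ, hE⟩ := grid_iter hcn hX hδ hn2 hmid hY (En_le ha hKa hn0) (En_le hb hKb hn0)
    (show 0 < (ε/2)^2 / n by positivity)
  let ε' := min (ε / (2*n)) (δ/4)
  have hε' : 0 < ε' := lt_min (by positivity) (by linarith)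
  choose e he using fun y z : X => hX.exists_path y z hε'
  have hes : ∀ y z : X, d y z < δ/4 → cost (e y z) < ENNReal.ofReal (δ/2) := by
    intro y z h
    refine (he y z).trans_lt ?_
    have : ε' ≤ δ/4 := min_le_right _ _
    exact (ENNReal.ofReal_lt_ofReal_iff (by linarith)).2 (by linarith)
  have col := column hlsc (η := δ/2) (by linarith) (by linarith) e a q ha hq hn0 hnK (hLn.trans_le hδδ0) Z
    (fun j i hj hi => hes _ _ (hZ.ver j i hj hi)) (fun j i hj hi => hes _ _ (hZ.hor j i hj hi))
    hZ.top hZ.bot hZ.lef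
  intro j hj
  refine (mCost_le (col j hj).symm).trans ?_
  rw [cost_chain]
  refine (Finset.sum_le_sum fun i _ => he (Z j i) (Z j (i+1))).trans ?_
  rw [← ENNReal.ofReal_sum_of_nonneg (fun i _ => by have := d_nonneg (Z j i) (Z j (i+1)); linarith)]
  apply ENNReal.ofReal_le_ofReal
  rw [Finset.sum_add_distrib]
  have h1 := sum_le_of_En hn0 (Z j) hA (half_pos hε) (hE j hj)
  have h2 : ∑ i ∈ Finset.range n, ε' ≤ ε/2 := by
    rw [Finset.sum_const, Finset.card_range, nsmul_eq_mul]
    have : ε' ≤ ε / (2*n) := min_le_left _ _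
    calc (n:ℝ) * ε' ≤ n * (ε / (2*n)) := by gcongr
      _ = _ := by field_simp
  linarith

lemma conv (hX : Good X) {o u v : X} {a : Path o u} {b : Path o v} {q : Path u v} {Ka Kb A L : ℝ}
    (ha : Lip a Ka) (hb : Lip b Kb) (hKa : Ka ≤ A) (hKb : Kb ≤ A) (hq : Lip q L)
    (hopt : ∀ r : Path u v, q.Homotopic r → ENNReal.ofReal L ≤ cost r) (hab : (a.trans q).Homotopic b) (t : I) :
    mCost (a.trans (subpath0 q t)) ≤ ENNReal.ofReal A := by
  have hA : 0 ≤ A := ha.1.trans hKa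
  have hL := hq.1
  apply ENNReal.le_of_forall_pos_le_add
  intro ε hε _
  have hε2 : (0:ℝ) < ε/2 := by positivity
  have ev : ∀ᶠ n : ℕ in atTop, L / n < ε/2 := 
    (tendsto_const_div_atTop_nhds_zero_nat L).eventually (gt_mem_nhds hε2)
  obtain ⟨n, h1, h2, hn0⟩ := ((conv_aux hX ha hb hKa hKb hq hopt hab hε2).and (ev.and (eventually_gt_atTop 0))).exists
  have hnr : (0:ℝ) < n := Nat.cast_pos.2 hn0
  let j := ⌊t.1 * n⌋₊
  have ht0 := t.2.1
  have ht1 := t.2.2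
  have hj1 : (j:ℝ) ≤ t.1 * n := Nat.floor_le (by positivity)
  have hj2 : t.1 * n < j + 1 := Nat.lt_floor_add_one _
  have hjn : j ≤ n := by
    have : (j:ℝ) ≤ n := hj1.trans (by nlinarith)
    exact_mod_cast this
  have hle : tk n j ≤ t := by
    show (tk n j).1 ≤ t.1
    rw [tk_val hjn]; rwa [div_le_iff₀ hnr]
  have hdiff : L * (t.1 - (tk n j).1) ≤ L / n := by
    rw [tk_val hjn, div_eq_mul_one_div L]
    gcongr
    rw [sub_le_iff_le_add, ← add_div, le_div_iff₀ hnr]; linarith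
  have hh : HR ((a.trans (subpath0 q (tk n j))).trans (subpath q (tk n j) t)) (a.trans (subpath0 q t)) :=
    (HR.assoc _ _ _).trans (HR.comp HR.rfl' (HR.subpath0_trans q _ _))
  rw [← mCost_congr hh]
  refine (mCost_trans_le _ _).trans ?_
  refine (add_le_add (h1 j hjn) ((mCost_le HR.rfl').trans (hq.sub_sub hle))).trans ?_
  rw [← ENNReal.ofReal_add (by linarith) (mul_nonneg hL (sub_nonneg.2 hle)), ← ENNReal.ofReal_coe_nnreal, 
    ← ENNReal.ofReal_add hA (by positivity)]
  apply ENNReal.ofReal_le_ofReal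
  linarith

end THPP
end
section
namespace THPP
set_option linter.all false
local notation "I" => unitInterval
open Filter Topology
variable {X : Set E2}

lemma opt_cs (hmin : ∀ (a b : X) (p : Path a b), ∃ q : Path a b, p.Homotopic q ∧
      ∀ r : Path a b, p.Homotopic r → cost q ≤ cost r) {a b : X} (p : Path a b) (hp : mCost p ≠ ⊤) :
    ∃ q : Path a b, p.Homotopic q ∧ cost q ≠ ⊤ ∧ cost q ≤ mCost p ∧ IsOptimal q ∧ Lip q (cost q).toReal ∧
      ∀ r : Path a b, p.Homotopic r → cost q ≤ cost r := by
  obtain ⟨q0, h1, h2⟩ := hmin a b p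
  have h3 : cost q0 ≤ mCost p := le_iInf fun r => h2 r.1 r.2
  have h4 : cost q0 ≠ ⊤ := ne_top_of_le_ne_top hp h3
  obtain ⟨q, hq, hc, hl⟩ := exists_cs q0 h4
  have hpq := h1.trans hq
  have he : cost q = cost q0 := le_antisymm hc (h2 q hpq)
  refine ⟨q, hpq, he ▸ h4, he ▸ h3, fun r hr => ?_, ⟨ENNReal.toReal_nonneg, ?_⟩, fun r hr => ?_⟩
  · rw [he]; exact h2 r (hpq.trans hr)
  · rw [he]; exact hl
  · rw [he]; exact h2 r hr

section
variable {Y : Type*} [TopologicalSpace Y] {a b c : Y}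

lemma sub_left (p : Path a b) (q : Path b c) (t : I) (s : I) (h : s.1 = t.1 / 2) :
    HR (subpath0 (p.trans q) s) (subpath0 p t) := by
  apply HR.of_eq
  intro r
  show (p.trans q) ⟨(1 - r.1) * (0:I).1 + r.1 * s.1, _⟩ = p ⟨(1 - r.1) * (0:I).1 + r.1 * t.1, _⟩
  rw [Path.trans_apply]
  have hr0 := r.2.1; have hr1 := r.2.2; have := t.2.1; have := t.2.2
  have hle : (1 - r.1) * (0:I).1 + r.1 * s.1 ≤ 1/2 := by
    rw [h]; simp only [Set.Icc.coe_zero]; nlinarith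
  rw [dif_pos hle]
  congr 1
  apply Subtype.ext
  show 2 * ((1 - r.1) * (0:I).1 + r.1 * s.1) = (1 - r.1) * (0:I).1 + r.1 * t.1
  rw [h]; simp only [Set.Icc.coe_zero]; ring

lemma sub_right (p : Path a b) (q : Path b c) (t : I) (s : I) (h : s.1 = (1 + t.1) / 2) :
    HR (subpath0 (p.trans q) s) (p.trans (subpath0 q t)) := by
  let w : I := ⟨1/2, by norm_num, by norm_num⟩
  refine (HR.subpath0_trans (p.trans q) w s).symm.trans (HR.comp ?_ ?_)
  · exact (sub_left p q 1 w (by simp [w])).trans (HR.subpath0_one p)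
  · apply HR.of_eq
    intro r
    show (p.trans q) ⟨(1 - r.1) * (1/2) + r.1 * s.1, _⟩ = q ⟨(1 - r.1) * (0:I).1 + r.1 * t.1, _⟩
    rw [Path.trans_apply]
    have hr0 := r.2.1; have hr1 := r.2.2; have := t.2.1; have := t.2.2
    have hrt : 0 ≤ r.1 * t.1 := by positivity
    split_ifs with hle
    · have hle' : (1 - r.1) * (1/2) + r.1 * s.1 ≤ 1/2 := hle
      rw [h] at hle'
      have h0 : r.1 * t.1 = 0 := by nlinarith
      have e1 : (⟨2 * ((1 - r.1) * (1/2) + r.1 * s.1), (unitInterval.mul_pos_mem_iff zero_lt_two).2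
        ⟨by rw [h]; nlinarith, hle⟩⟩ : I) = 1 := by
        apply Subtype.ext
        show 2 * ((1 - r.1) * (1/2) + r.1 * s.1) = 1
        rw [h]; linarith
      have e2 : (⟨(1 - r.1) * (0:I).1 + r.1 * t.1, subIcc_mem r 0 t⟩ : I) = 0 := by
        apply Subtype.ext
        show (1 - r.1) * (0:I).1 + r.1 * t.1 = 0
        rw [h0]; simp
      exact (congrArg p e1).trans (p.target.trans (q.source.symm.trans (congrArg q e2).symm))
    · congr 1
      apply Subtype.ext
      show 2 * ((1 - r.1) * (1/2) + r.1 * s.1) - 1 = (1 - r.1) * (0:I).1 + r.1 * t.1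
      rw [h]; simp only [Set.Icc.coe_zero]; ring

lemma chain_sub (x : ℕ → Y) (σ : ∀ i : ℕ, Path (x i) (x (i+1))) (n : ℕ) :
    ∀ i ≤ n, ∃ t, HR (subpath0 (chain x σ n) t) (chain x σ i) := by
  induction n with
  | zero => intro i hi; obtain rfl : i = 0 := by omega
            exact ⟨1, HR.subpath0_one _⟩
  | succ n ih =>
    intro i hi
    rcases Nat.lt_or_ge n i with h | h
    · obtain rfl : i = n + 1 := by omega
      exact ⟨1, HR.subpath0_one _⟩
    · obtain ⟨t, ht⟩ := ih i h
      exact ⟨⟨t.1/2, by linarith [t.2.1], by linarith [t.2.2]⟩, (sub_left _ _ t _ rfl).trans ht⟩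

lemma chain_congr (x : ℕ → Y) (σ σ' : ∀ i : ℕ, Path (x i) (x (i+1))) (h : ∀ i, (σ i).Homotopic (σ' i)) (n : ℕ) :
    HR (chain x σ n) (chain x σ' n) := by
  induction n with
  | zero => exact HR.rfl'
  | succ n ih => exact HR.comp ih (HR.of_hom (h n))
end

lemma feas_ind (x : ℕ → X) (σ : ∀ i : ℕ, Path (x i) (x (i+1))) {o : X} (s : Path o (x 0)) {Z : ENNReal} (n : ℕ)
    (h0 : mCost s ≤ Z) (h : ∀ i < n, ∀ t, mCost (s.trans ((chain x σ i).trans (subpath0 (σ i) t))) ≤ Z) (t : I) :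
    mCost (s.trans (subpath0 (chain x σ n) t)) ≤ Z := by
  induction n generalizing t with
  | zero => 
    have : HR (subpath0 (chain x σ 0) t) (Path.refl (x 0)) := HR.of_eq fun r => rfl
    rw [mCost_congr ((HR.comp HR.rfl' this).trans (HR.trans_refl _))]
    exact h0
  | succ n ih =>
    rcases le_total t.1 (1/2) with ht | ht
    · have := sub_left (chain x σ n) (σ n) ⟨2 * t.1, by linarith [t.2.1], by linarith⟩ t (by simp)
      refine le_of_eq_of_le (mCost_congr (HR.comp HR.rfl' this)) ?_
      exact ih (fun i hi => h i (by omega)) _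
    · have := sub_right (chain x σ n) (σ n) ⟨2 * t.1 - 1, by linarith, by linarith [t.2.2]⟩ t (by simp)
      refine le_of_eq_of_le (mCost_congr (HR.comp HR.rfl' this)) ?_
      exact h n (by omega) _

lemma HR.cancel {o u v : X} {a : Path o u} {b : Path o v} {σ : Path u v} (h : HR (a.trans σ) b) :
    HR σ (a.symm.trans b) :=
  (HR.refl_trans σ).symm.trans ((HR.comp (HR.symm_trans a).symm HR.rfl').trans
    ((HR.assoc _ _ _).trans (HR.comp HR.rfl' h)))

end THPP
end
namespace THPP
/-- for a cost-minimal feasible TMV loop `γ* = σ₁ * ⋯ * σ_{N+1}`, there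
exist optimal homotopic configurations `ς*_i` from the anchor to the goals, of cost at
most ζ, with `ς*_0 = ς*_{N+1} = ς_s`, such that each subpath `σ_i` is an optimal
homotopic path satisfying `σ_i ≃_p ς̄*_{i-1} * ς*_i`. -/
theorem tmv_optimal_decomposition {X : Set E2} (hcomp : IsCompact X)
    (hpc : IsPathConnected X)
    (hpoly : ∃ (n : ℕ) (P : Fin n → Finset E2), X = ⋃ i, convexHull ℝ (↑(P i) : Set E2))
    (hmin : ∀ (a b : X) (p : Path a b), ∃ q : Path a b, p.Homotopic q ∧
      ∀ r : Path a b, p.Homotopic r → cost q ≤ cost r)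
    (xstar : X) {ζ : ℝ} (hζ : 0 ≤ ζ) (N : ℕ)
    (x : ℕ → X) (hxN : x (N + 1) = x 0)
    (ςs : Path xstar (x 0)) (hcs : cost ςs ≤ ENNReal.ofReal ζ)
    (σstar : ∀ i : ℕ, Path (x i) (x (i + 1)))
    (hfeas : FeasibleTMV ζ N x hxN ςs σstar)
    (hbest : ∀ σ : ∀ i : ℕ, Path (x i) (x (i + 1)), FeasibleTMV ζ N x hxN ςs σ →
      cost (chain x σstar (N + 1)) ≤ cost (chain x σ (N + 1))) :
    ∃ ς : ∀ i : ℕ, Path xstar (x i),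
      ς 0 = ςs ∧ ς (N + 1) = ςs.cast rfl hxN ∧
      (∀ i, 1 ≤ i → i ≤ N → IsOptimal (ς i) ∧ cost (ς i) ≤ ENNReal.ofReal ζ) ∧
      (∀ i ≤ N, IsOptimal (σstar i) ∧
        (σstar i).Homotopic ((ς i).symm.trans (ς (i + 1)))) := by

  have hX : Good X := ⟨hcomp, hpc, fun p hp => exists_chart hpoly hp⟩
  have hm : ∀ i ≤ N + 1, mCost (ςs.trans (chain x σstar i)) ≤ ENNReal.ofReal ζ := by
    intro i hi
    obtain ⟨t, ht⟩ := chain_sub x σstar (N+1) i hi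
    rw [← mCost_congr (HR.comp HR.rfl' ht)]
    exact hfeas.1 t
  have hA : ∀ i, ∃ q : Path xstar (x i), i ≤ N + 1 → HR q (ςs.trans (chain x σstar i)) ∧
      Lip q (cost q).toReal ∧ cost q ≤ ENNReal.ofReal ζ ∧ IsOptimal q := by
    intro i
    by_cases hi : i ≤ N + 1
    · obtain ⟨q, h1, h2, h3, h4, h5, h6⟩ := opt_cs hmin (ςs.trans (chain x σstar i))
        (ne_top_of_le_ne_top ENNReal.ofReal_ne_top (hm i hi))
      exact ⟨q, fun _ => ⟨(HR.of_hom h1).symm, h5, h3.trans (hm i hi), h4⟩⟩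
    · exact ⟨ςs.trans (chain x σstar i), fun h => absurd h hi⟩
  choose a ha using hA
  have haσ : ∀ i ≤ N, HR ((a i).trans (σstar i)) (a (i+1)) := by
    intro i hi
    refine (HR.comp (ha i (by omega)).1 HR.rfl').trans ((HR.assoc _ _ _).trans ?_)
    exact (ha (i+1) (by omega)).1.symm
  have hS : ∀ i, ∃ q : Path (x i) (x (i+1)), (σstar i).Homotopic q ∧ (i ≤ N → cost q ≠ ⊤ ∧
      Lip q (cost q).toReal ∧ ∀ r, (σstar i).Homotopic r → cost q ≤ cost r) := by
    intro i
    by_cases hi : i ≤ N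
    · have hfin : mCost (σstar i) ≠ ⊤ := by
        refine ne_top_of_le_ne_top ?_ (mCost_le (HR.cancel (haσ i hi)))
        rw [cost_trans, cost_symm]
        exact ENNReal.add_ne_top.2 ⟨ne_top_of_le_ne_top ENNReal.ofReal_ne_top (ha i (by omega)).2.2.1,
          ne_top_of_le_ne_top ENNReal.ofReal_ne_top (ha (i+1) (by omega)).2.2.1⟩
      obtain ⟨q, h1, h2, h3, h4, h5, h6⟩ := opt_cs hmin (σstar i) hfin
      exact ⟨q, h1, fun _ => ⟨h2, h5, h6⟩⟩
    · exact ⟨σstar i, Path.Homotopic.refl _, fun h => absurd h hi⟩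
  choose σ' hσ1 hσ2 using hS
  have hcc := fun n => chain_congr x σstar σ' hσ1 n
  have htoR : ∀ i ≤ N + 1, (cost (a i)).toReal ≤ ζ := fun i hi =>
    ENNReal.toReal_le_of_le_ofReal hζ (ha i hi).2.2.1
  have hfeas' : FeasibleTMV ζ N x hxN ςs σ' := by
    refine ⟨fun t => feas_ind x σ' ςs (N+1) ((mCost_le HR.rfl').trans hcs) ?_ t, ?_⟩
    · intro i hi t
      have hi' : i ≤ N := by omega
      obtain ⟨g1, g2, g3⟩ := hσ2 i hi'
      have key := conv hX (ha i (by omega)).2.1 (ha (i+1) (by omega)).2.1 (htoR i (by omega))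
        (htoR (i+1) (by omega)) g2 (fun r hr => by
          rw [ENNReal.ofReal_toReal g1]; exact g3 r ((hσ1 i).trans hr))
        ((HR.comp HR.rfl' (HR.of_hom (hσ1 i)).symm).trans (haσ i hi')).hom t
      refine le_of_eq_of_le (mCost_congr ?_) key
      refine (HR.assoc _ _ _).symm.trans (HR.comp ?_ HR.rfl')
      exact (HR.comp HR.rfl' (hcc i).symm).trans (ha i (by omega)).1.symm
    · exact ((HR.comp HR.rfl' (hcc (N+1)).symm).trans (HR.of_hom hfeas.2)).hom
  have hle : ∀ i ∈ Finset.range (N+1), cost (σ' i) ≤ cost (σstar i) := fun i hi =>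
    (hσ2 i (by have := Finset.mem_range.1 hi; omega)).2.2 _ (Path.Homotopic.refl _)
  have hb := hbest σ' hfeas'
  rw [cost_chain, cost_chain] at hb
  have heq : ∀ i ≤ N, cost (σstar i) ≤ cost (σ' i) := by
    intro i hi
    have him : i ∈ Finset.range (N+1) := Finset.mem_range.2 (by omega)
    rw [← Finset.add_sum_erase _ _ him, ← Finset.add_sum_erase _ _ him] at hb
    have hsub : ∑ k ∈ (Finset.range (N+1)).erase i, cost (σ' k) ≤ ∑ k ∈ (Finset.range (N+1)).erase i, cost (σstar k) :=
      Finset.sum_le_sum fun k hk => hle k (Finset.mem_of_mem_erase hk)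
    have hne : ∑ k ∈ (Finset.range (N+1)).erase i, cost (σ' k) ≠ ⊤ := by
      refine ENNReal.sum_ne_top.2 fun k hk => (hσ2 k ?_).1
      have := Finset.mem_range.1 (Finset.mem_of_mem_erase hk); omega
    exact (ENNReal.add_le_add_iff_right hne).1 ((add_le_add le_rfl hsub).trans hb)
  let ς : ∀ i : ℕ, Path xstar (x i) := fun i =>
    if h : i = 0 then ςs.cast rfl (by rw [h]) else
      if h' : i = N + 1 then ςs.cast rfl (by rw [h', hxN]) else a i
  have h0 : ς 0 = ςs := by
    show dite _ _ _ = _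
    rw [dif_pos rfl]; rfl
  have hN : ς (N+1) = ςs.cast rfl hxN := by
    show dite _ _ _ = _
    rw [dif_neg (by omega), dif_pos rfl]
  have hi : ∀ i, 1 ≤ i → i ≤ N → ς i = a i := by
    intro i h1 h2
    show dite _ _ _ = _
    rw [dif_neg (by omega), dif_neg (by omega)]
  have hςa : ∀ i ≤ N + 1, HR (ς i) (ςs.trans (chain x σstar i)) := by
    intro i hiN
    rcases Nat.eq_zero_or_pos i with h | h
    · subst h; rw [h0]; exact (HR.trans_refl ςs).symm
    · rcases Nat.lt_or_ge N i with h' | h'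
      · obtain rfl : i = N + 1 := by omega
        rw [hN]; exact (HR.of_hom hfeas.2).symm
      · rw [hi i h h']; exact (ha i hiN).1
  refine ⟨ς, h0, hN, ?_, ?_⟩
  · intro i h1 h2
    rw [hi i h1 h2]
    exact ⟨(ha i (by omega)).2.2.2, (ha i (by omega)).2.2.1⟩
  · intro i hiN
    refine ⟨fun r hr => (heq i hiN).trans ((hσ2 i hiN).2.2 r hr), (HR.cancel ?_).hom⟩
    refine (HR.comp (hςa i (by omega)) HR.rfl').trans ((HR.assoc _ _ _).trans ?_)
    exact (hςa (i+1) (by omega)).symm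

end THPP
end
end

section
/- Let X_free ⊆ ℝ² and let ς_a, ς_b, ς_c be paths in X_free all starting at the anchor x⋆ and ending at x_a, x_b, x_c respectively. Suppose σ₁ is an optimal homotopic path with σ₁ ≃_p ς̄_a * ς_b, σ₂ is an optimal homotopic path with σ₂ ≃_p ς̄_b * ς_c, and σ₃ is an optimal homotopic path with σ₃ ≃_p ς̄_a * ς_c. Then c(σ₁ * σ₂) ≥ c(σ₃), i.e., c(σ₁) + c(σ₂) ≥ c(σ₃). Consequently, every edge cost c(γ_k) − c(γ_{k−1}) in the directed graph G_TMV of the tethered multi-goal visiting problem is nonnegative, so G_TMV is a positive-weight graph. -/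
noncomputable section

namespace THPP

lemma cost_trans_le {X : Set E2} {a b c : X} (σ : Path a b) (τ : Path b c) :
    cost (σ.trans τ) ≤ cost σ + cost τ := by
  have hh : (1 / 2 : ℝ) ∈ Set.Icc (0 : ℝ) 1 := by constructor <;> norm_num
  let h : unitInterval := ⟨1 / 2, hh⟩
  have hu : (Set.univ : Set unitInterval) = Set.Iic h ∪ Set.Ici h := by
    ext t; simp [le_total]
  have h1 : eVariationOn (fun t => ((σ.trans τ) t : E2)) (Set.Iic h) ≤ cost σ := by
    let φ : unitInterval → unitInterval := fun t => Set.projIcc 0 1 zero_le_one (2 * (t : ℝ))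
    have hφ : Monotone φ := fun s t hst => Set.monotone_projIcc _ (by
      have : (s : ℝ) ≤ t := hst
      linarith)
    refine le_trans (le_of_eq (eVariationOn.congr ?_))
      (eVariationOn.comp_le_of_monotoneOn (fun t => (σ t : E2)) φ (hφ.monotoneOn _)
        (fun _ _ => Set.mem_univ _))
    intro t ht
    have ht' : (t : ℝ) ≤ 1 / 2 := ht
    have h0 : (0 : ℝ) ≤ t := t.2.1
    simp only [Function.comp, Path.trans_apply, dif_pos ht', φ]
    rw [Set.projIcc_of_mem]
  have h2 : eVariationOn (fun t => ((σ.trans τ) t : E2)) (Set.Ici h) ≤ cost τ := by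
    let φ : unitInterval → unitInterval := fun t => Set.projIcc 0 1 zero_le_one (2 * (t : ℝ) - 1)
    have hφ : Monotone φ := fun s t hst => Set.monotone_projIcc _ (by
      have : (s : ℝ) ≤ t := hst
      linarith)
    refine le_trans (le_of_eq (eVariationOn.congr ?_))
      (eVariationOn.comp_le_of_monotoneOn (fun t => (τ t : E2)) φ (hφ.monotoneOn _)
        (fun _ _ => Set.mem_univ _))
    intro t ht
    have ht' : 1 / 2 ≤ (t : ℝ) := ht
    have h0 : (t : ℝ) ≤ 1 := t.2.2
    have hm : 2 * (t : ℝ) - 1 ∈ Set.Icc (0 : ℝ) 1 := ⟨by linarith, by linarith⟩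
    simp only [Function.comp, φ]
    rw [Set.projIcc_of_mem _ hm, Path.trans_apply]
    split_ifs with hle
    · have he : (t : ℝ) = 1 / 2 := le_antisymm hle ht'
      simp [he]
    · rfl
  unfold cost at h1 h2 ⊢
  rw [hu, eVariationOn.union _ (x := h) isGreatest_Iic isLeast_Ici, ← hu]
  exact add_le_add h1 h2

lemma homotopic_aux {Y : Type*} [TopologicalSpace Y] {s a b c : Y}
    (p : Path s a) (q : Path s b) (r : Path s c) :
    (p.symm.trans r).Homotopic ((p.symm.trans q).trans (q.symm.trans r)) := by
  have e1 : ((p.symm.trans q).trans (q.symm.trans r)).Homotopic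
      (p.symm.trans (q.trans (q.symm.trans r))) := ⟨Path.Homotopy.transAssoc _ _ _⟩
  have e2 : ((q.trans q.symm).trans r).Homotopic (q.trans (q.symm.trans r)) :=
    ⟨Path.Homotopy.transAssoc _ _ _⟩
  have e3 : (Path.refl s).Homotopic (q.trans q.symm) := ⟨Path.Homotopy.reflTransSymm q⟩
  have e4 : ((Path.refl s).trans r).Homotopic r := ⟨Path.Homotopy.reflTrans r⟩
  have e5 : r.Homotopic (q.trans (q.symm.trans r)) :=
    (e4.symm.trans (e3.hcomp (Path.Homotopic.refl r))).trans e2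
  exact ((Path.Homotopic.refl p.symm).hcomp e5).trans e1.symm

/-- if `σ₁ ≃_p ς̄_a * ς_b`, `σ₂ ≃_p ς̄_b * ς_c` and `σ₃ ≃_p ς̄_a * ς_c`
are optimal homotopic paths, then `c(σ₁ * σ₂) = c(σ₁) + c(σ₂) ≥ c(σ₃)`; hence every
edge cost in the TMV graph is nonnegative. -/
theorem tmv_edge_cost_nonneg {X : Set E2} {xstar xa xb xc : X}
    (ςa : Path xstar xa) (ςb : Path xstar xb) (ςc : Path xstar xc)
    (σ₁ : Path xa xb) (h₁o : IsOptimal σ₁) (h₁h : σ₁.Homotopic (ςa.symm.trans ςb))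
    (σ₂ : Path xb xc) (h₂o : IsOptimal σ₂) (h₂h : σ₂.Homotopic (ςb.symm.trans ςc))
    (σ₃ : Path xa xc) (h₃o : IsOptimal σ₃) (h₃h : σ₃.Homotopic (ςa.symm.trans ςc)) :
    cost σ₃ ≤ cost (σ₁.trans σ₂) ∧ cost σ₃ ≤ cost σ₁ + cost σ₂ := by
  have key : cost σ₃ ≤ cost (σ₁.trans σ₂) :=
    h₃o _ ((h₃h.trans (homotopic_aux ςa ςb ςc)).trans (h₁h.hcomp h₂h).symm)
  exact ⟨key, key.trans (cost_trans_le σ₁ σ₂)⟩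

end THPP
end
end

section
/- Let X_free ⊆ ℝ² be such that every path-homotopy class of paths in X_free contains a path of minimal cost. Let σ⊛ be a globally optimal path in X_free from x_s to x_g (c(σ⊛) ≤ c(σ) for every path σ in X_free from x_s to x_g), and let x⋆ ∈ X_free be a point admitting a path in X_free from x⋆ to x_s. Then there exist optimal homotopic paths σ*_s ∈ P(X_free; x⋆, x_s) and σ*_g ∈ P(X_free; x⋆, x_g) such that σ⊛ ≃_p σ̄*_s * σ*_g. -/
noncomputable section

namespace THPP

/-- a globally optimal path `σ⊛` from `x_s` to `x_g` factors through any
anchor `x⋆` connected to `x_s`: there are optimal homotopic paths `σ*_s` from `x⋆` to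
`x_s` and `σ*_g` from `x⋆` to `x_g` with `σ⊛ ≃_p σ̄*_s * σ*_g`. -/
theorem global_optimal_factorization {X : Set E2}
    (hmin : ∀ (a b : X) (p : Path a b), ∃ q : Path a b, p.Homotopic q ∧
      ∀ r : Path a b, p.Homotopic r → cost q ≤ cost r)
    {xs xg : X} (σstar : Path xs xg)
    (hopt : ∀ σ' : Path xs xg, cost σstar ≤ cost σ')
    (xstar : X) (hjoin : Joined xstar xs) :
    ∃ (σs : Path xstar xs) (σg : Path xstar xg),
      IsOptimal σs ∧ IsOptimal σg ∧ σstar.Homotopic (σs.symm.trans σg) := by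
  obtain ⟨p⟩ := hjoin
  obtain ⟨σs, h1, h2⟩ := hmin _ _ p
  obtain ⟨σg, h3, h4⟩ := hmin _ _ (σs.trans σstar)
  refine ⟨σs, σg, fun r hr => h2 r (h1.trans hr), fun r hr => h4 r (h3.trans hr), ?_⟩
  have e1 : (σs.symm.trans (σs.trans σstar)).Homotopic (σs.symm.trans σg) :=
    Path.Homotopic.hcomp (Path.Homotopic.refl _) h3
  have e2 : ((σs.symm.trans σs).trans σstar).Homotopic (σs.symm.trans (σs.trans σstar)) :=
    ⟨Path.Homotopy.transAssoc _ _ _⟩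
  have e3 : ((Path.refl xs).trans σstar).Homotopic ((σs.symm.trans σs).trans σstar) :=
    Path.Homotopic.hcomp ⟨Path.Homotopy.reflSymmTrans σs⟩ (Path.Homotopic.refl _)
  have e4 : ((Path.refl xs).trans σstar).Homotopic σstar := ⟨Path.Homotopy.reflTrans σstar⟩
  exact e4.symm.trans (e3.trans (e2.trans e1))

end THPP
end
end
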